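/- arXiv:cs/0305016 — 2 statements merged into one kernel-verified Lean document; each statement's English description precedes it below -/
import Mathlib

section
/- Let n ≥ 3 be a natural number and let ρ be a real number with √2/n < ρ ≤ 1. Then for every finite set W ⊆ Q with |W| = n there exists a finite set B ⊆ Q with |B| = n such that μ({q ∈ Q : infDist(q, B) < infDist(q, W)}) > ρ/2. (Barney has a winning strategy for n ≥ 3 and aspect ratio ρ > √2/n.) -/
open MeasureTheory Metric Set
open scoped ENNReal

/-- The point `(x, y)` in the Euclidean plane. -/
noncomputable def pt (x y : ℝ) : EuclideanSpace ℝ (Fin 2) :=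
  (WithLp.equiv 2 (Fin 2 → ℝ)).symm ![x, y]

/-- The rectangular board `[0,1] × [0,ρ]`. -/
def board (ρ : ℝ) : Set (EuclideanSpace ℝ (Fin 2)) :=
  {q | q 0 ∈ Set.Icc (0:ℝ) 1 ∧ q 1 ∈ Set.Icc (0:ℝ) ρ}

namespace VG
open Filter Topology

def d2 (p q : ℝ × ℝ) : ℝ := (p.1 - q.1)^2 + (p.2 - q.2)^2
def dot (p q : ℝ × ℝ) : ℝ := p.1 * q.1 + p.2 * q.2
def Q (ρ : ℝ) : Set (ℝ × ℝ) := {q | 0 ≤ q.1 ∧ q.1 ≤ 1 ∧ 0 ≤ q.2 ∧ q.2 ≤ ρ}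
def Qo (ρ : ℝ) : Set (ℝ × ℝ) := {q | 0 < q.1 ∧ q.1 < 1 ∧ 0 < q.2 ∧ q.2 < ρ}
def O (W : Finset (ℝ × ℝ)) (ρ : ℝ) (w : ℝ × ℝ) : Set (ℝ × ℝ) :=
  {q | q ∈ Qo ρ ∧ ∀ w' ∈ W, w' ≠ w → d2 q w < d2 q w'}
def C (W : Finset (ℝ × ℝ)) (ρ : ℝ) (w : ℝ × ℝ) : Set (ℝ × ℝ) :=
  {q | q ∈ Q ρ ∧ ∀ w' ∈ W, d2 q w ≤ d2 q w'}
def Win (W : Finset (ℝ × ℝ)) (ρ : ℝ) : Prop :=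
  ∃ B : Finset (ℝ × ℝ), (↑B ⊆ Q ρ) ∧ B.card = W.card ∧
    ρ / 2 < volume.real {q | q ∈ Q ρ ∧ ∃ b ∈ B, ∀ w ∈ W, d2 q b < d2 q w}
/-- half cell -/
def Hf (W : Finset (ℝ × ℝ)) (ρ : ℝ) (w u : ℝ × ℝ) : Set (ℝ × ℝ) :=
  {q | q ∈ O W ρ w ∧ 0 < dot (q - w) u}

lemma Q_eq (ρ : ℝ) : Q ρ = Icc 0 1 ×ˢ Icc 0 ρ := by
  ext q; simp only [Q, mem_setOf_eq, mem_prod, mem_Icc, and_assoc]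
lemma Qo_eq (ρ : ℝ) : Qo ρ = Ioo 0 1 ×ˢ Ioo 0 ρ := by
  ext q; simp only [Qo, mem_setOf_eq, mem_prod, mem_Ioo, and_assoc]
lemma vol_Q {ρ : ℝ} (h : 0 < ρ) : volume.real (Q ρ) = ρ := by
  rw [Q_eq, Measure.volume_eq_prod, measureReal_prod_prod]; simp [h.le]
lemma vol_Qo {ρ : ℝ} (h : 0 < ρ) : volume.real (Qo ρ) = ρ := by
  rw [Qo_eq, Measure.volume_eq_prod, measureReal_prod_prod]; simp [h.le]
lemma fin_Q (ρ : ℝ) : volume (Q ρ) < ⊤ := by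
  rw [Q_eq]; exact (isCompact_Icc.prod isCompact_Icc).measure_lt_top
lemma Qo_sub (ρ : ℝ) : Qo ρ ⊆ Q ρ := fun q hq => ⟨hq.1.le, hq.2.1.le, hq.2.2.1.le, hq.2.2.2.le⟩
lemma fin_sub {ρ : ℝ} {S : Set (ℝ × ℝ)} (h : S ⊆ Q ρ) : volume S ≠ ⊤ :=
  ((measure_mono h).trans_lt (fin_Q ρ)).ne
lemma O_sub (W : Finset (ℝ × ℝ)) (ρ : ℝ) (w) : O W ρ w ⊆ Q ρ := fun _ h => Qo_sub ρ h.1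
lemma O_sub_C (W : Finset (ℝ × ℝ)) (ρ : ℝ) (w) : O W ρ w ⊆ C W ρ w := by
  intro q h
  refine ⟨Qo_sub ρ h.1, fun w' hw' => ?_⟩
  by_cases e : w' = w
  · rw [e]
  · exact (h.2 w' hw' e).le
lemma Hf_sub (W : Finset (ℝ × ℝ)) (ρ : ℝ) (w u) : Hf W ρ w u ⊆ O W ρ w := fun _ h => h.1
lemma cont_d2 (w : ℝ × ℝ) : Continuous (fun q => d2 q w) := by unfold d2; fun_prop
lemma isOpen_Qo (ρ : ℝ) : IsOpen (Qo ρ) := by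
  rw [Qo_eq]; exact isOpen_Ioo.prod isOpen_Ioo
lemma isOpen_O (W : Finset (ℝ × ℝ)) (ρ : ℝ) (w) : IsOpen (O W ρ w) := by
  have : O W ρ w = Qo ρ ∩ ⋂ w' ∈ W.filter (· ≠ w), {q | d2 q w < d2 q w'} := by
    ext q; simp [O]
  rw [this]
  exact (isOpen_Qo ρ).inter (isOpen_biInter_finset fun w' _ => isOpen_lt (cont_d2 _) (cont_d2 _))
lemma isOpen_Hf (W : Finset (ℝ × ℝ)) (ρ : ℝ) (w u) : IsOpen (Hf W ρ w u) := by
  have : IsOpen {q : ℝ × ℝ | 0 < dot (q - w) u} := by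
    refine isOpen_lt continuous_const ?_
    unfold dot; fun_prop
  exact (isOpen_O W ρ w).inter this
lemma O_disj {W : Finset (ℝ × ℝ)} {ρ : ℝ} {w q k} (hk : k ∈ W) (hq : q ∈ O W ρ w)
    (hC : q ∈ C W ρ k) (hw : w ∈ W) : k = w := by
  by_contra e
  exact absurd (hq.2 k hk e) (not_lt.mpr (hC.2 w hw))

lemma Q_inf {ρ : ℝ} (h : 0 < ρ) : (Q ρ).Infinite := by
  intro hf
  have := hf.measure_zero volume
  have h2 := vol_Q h
  simp [Measure.real, this] at h2
  linarith

lemma win_of {W : Finset (ℝ × ℝ)} {ρ : ℝ} (hρ : 0 < ρ) (b : ℝ × ℝ → ℝ → ℝ × ℝ)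
    (R : ℝ × ℝ → Set (ℝ × ℝ)) (hm : ∀ j ∈ W, MeasurableSet (R j))
    (hR : ∀ j ∈ W, R j ⊆ Q ρ)
    (hd : (↑W : Set (ℝ × ℝ)).PairwiseDisjoint R)
    (hb : ∀ j ∈ W, ∀ᶠ δ in 𝓝[>] (0:ℝ), b j δ ∈ Q ρ)
    (hq : ∀ j ∈ W, ∀ q ∈ R j, ∀ᶠ δ in 𝓝[>] (0:ℝ), ∀ w ∈ W, d2 q (b j δ) < d2 q w)
    (hs : ρ / 2 < ∑ j ∈ W, volume.real (R j)) : Win W ρ := by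
  set U := ⋃ j ∈ W, R j with hU
  have hUQ : U ⊆ Q ρ := by simpa [hU] using hR
  have hUm : volume.real U = ∑ j ∈ W, volume.real (R j) :=
    measureReal_biUnion_finset hd hm (fun j hj => fin_sub (hR j hj))
  let δ : ℕ → ℝ := fun m => 1 / ((m:ℝ) + 1)
  have hδ : Tendsto δ atTop (𝓝[>] 0) := by
    rw [tendsto_nhdsWithin_iff]
    exact ⟨tendsto_one_div_add_atTop_nhds_zero_nat, Eventually.of_forall fun m => by
      simp only [δ, mem_Ioi]; positivity⟩
  let E : ℕ → Set (ℝ × ℝ) := fun m =>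
    {q | q ∈ U ∧ ∀ m' ≥ m, ∃ j ∈ W, ∀ w ∈ W, d2 q (b j (δ m')) < d2 q w}
  have hE : Monotone E := fun m m' h q hq => ⟨hq.1, fun k hk => hq.2 k (h.trans hk)⟩
  have hEU : ⋃ m, E m = U := by
    apply subset_antisymm
    · exact iUnion_subset fun m q hq => hq.1
    · intro q hqU
      simp only [hU, mem_iUnion] at hqU
      obtain ⟨j, hj, hqj⟩ := hqU
      obtain ⟨m, hm⟩ := eventually_atTop.mp (hδ.eventually (hq j hj q hqj))
      exact mem_iUnion.mpr ⟨m, mem_biUnion hj hqj, fun k hk => ⟨j, hj, hm k hk⟩⟩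
  have ht := tendsto_measure_iUnion_atTop (μ := (volume : Measure (ℝ × ℝ))) hE
  rw [hEU] at ht
  have hlt : ENNReal.ofReal (ρ / 2) < volume U := by
    rw [ENNReal.ofReal_lt_iff_lt_toReal (by positivity) (fin_sub hUQ)]
    change _ < volume.real U
    rwa [hUm]
  have hbQ : ∀ᶠ m in atTop, ∀ j ∈ W, b j (δ m) ∈ Q ρ := by
    rw [eventually_all_finset]
    exact fun j hj => hδ.eventually (hb j hj)
  obtain ⟨m, hm1, hm2⟩ := ((ht.eventually_const_lt hlt).and hbQ).exists
  classical
  obtain ⟨B, hB1, hB2, hB3⟩ : ∃ B : Finset (ℝ × ℝ), (W.image fun j => b j (δ m)) ⊆ B ∧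
      (↑B ⊆ Q ρ) ∧ B.card = W.card := by
    set A := W.image fun j => b j (δ m) with hA
    have hAQ : (↑A : Set (ℝ × ℝ)) ⊆ Q ρ := by
      intro x hx
      obtain ⟨j, hj, rfl⟩ := Finset.mem_image.mp (Finset.mem_coe.mp hx)
      exact hm2 j hj
    have hc : A.card ≤ W.card := Finset.card_image_le
    obtain ⟨t, ht1, ht2⟩ := ((Q_inf hρ).diff A.finite_toSet).exists_subset_card_eq
      (W.card - A.card)
    refine ⟨A ∪ t, Finset.subset_union_left, ?_, ?_⟩
    · rw [Finset.coe_union]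
      exact union_subset hAQ (ht1.trans diff_subset)
    · rw [Finset.card_union_of_disjoint, ht2]
      · omega
      · rw [Finset.disjoint_left]
        intro x hx hxt
        exact (ht1 hxt).2 hx
  refine ⟨B, hB2, hB3, ?_⟩
  have hsub : E m ⊆ {q | q ∈ Q ρ ∧ ∃ b ∈ B, ∀ w ∈ W, d2 q b < d2 q w} := by
    intro q hq
    obtain ⟨j, hj, h⟩ := hq.2 m le_rfl
    exact ⟨hUQ hq.1, _, hB1 (Finset.mem_image_of_mem _ hj), h⟩
  have := hm1.trans_le (measure_mono hsub)
  rwa [ENNReal.ofReal_lt_iff_lt_toReal (by positivity) (fin_sub fun q hq => hq.1)] at this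

end VG

namespace VG
open Filter Topology

lemma dot_sub_left (p q u : ℝ × ℝ) : dot (p - q) u = dot p u - dot q u := by
  simp [dot]; ring
lemma dot_neg_right (p u : ℝ × ℝ) : dot p (-u) = - dot p u := by
  simp [dot]; ring
lemma dot_neg_left (p u : ℝ × ℝ) : dot (-p) u = - dot p u := by
  simp [dot]; ring
lemma dot_self_pos {u : ℝ × ℝ} (hu : u ≠ 0) : 0 < dot u u := by
  have : u.1 ≠ 0 ∨ u.2 ≠ 0 := by
    by_contra h; push Not at h; exact hu (Prod.ext h.1 h.2)
  simp only [dot]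
  rcases this with h | h
  · have := mul_self_pos.mpr h; nlinarith [mul_self_nonneg u.2]
  · have := mul_self_pos.mpr h; nlinarith [mul_self_nonneg u.1]
lemma cont_dot (u : ℝ × ℝ) : Continuous (fun q => dot q u) := by unfold dot; fun_prop

def dotL (u : ℝ × ℝ) : ℝ × ℝ →ₗ[ℝ] ℝ where
  toFun q := dot q u
  map_add' p q := by simp [dot]; ring
  map_smul' c q := by simp [dot]; ring

lemma line_null {u : ℝ × ℝ} (hu : u ≠ 0) (c : ℝ) : volume {q : ℝ × ℝ | dot q u = c} = 0 := by
  set q0 : ℝ × ℝ := (c / dot u u) • u with hq0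
  have hd : dot q0 u = c := by
    have := dot_self_pos hu
    have h2 : dot q0 u = (c / dot u u) * dot u u := by simp [hq0, dot]; ring
    rw [h2]; field_simp
  have h := Measure.addHaar_affineSubspace (volume : Measure (ℝ × ℝ))
    (AffineSubspace.mk' q0 (LinearMap.ker (dotL u))) (by
      intro h
      have h1 : q0 + u ∈ AffineSubspace.mk' q0 (LinearMap.ker (dotL u)) := by
        rw [h]; trivial
      rw [AffineSubspace.mem_mk'] at h1
      simp [dotL] at h1
      exact (dot_self_pos hu).ne' h1)
  convert h using 2
  ext q
  simp only [SetLike.mem_coe, AffineSubspace.mem_mk', LinearMap.mem_ker]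
  show dot q u = c ↔ dot (q - q0) u = 0
  rw [dot_sub_left, hd, sub_eq_zero]

lemma d2_lt (q w w' : ℝ × ℝ) :
    d2 q w < d2 q w' ↔ dot q (w' - w) < (dot w' w' - dot w w) / 2 := by
  simp only [d2, dot, Prod.fst_sub, Prod.snd_sub]
  constructor <;> intro h <;> nlinarith
lemma d2_le (q w w' : ℝ × ℝ) :
    d2 q w ≤ d2 q w' ↔ dot q (w' - w) ≤ (dot w' w' - dot w w) / 2 := by
  simp only [d2, dot, Prod.fst_sub, Prod.snd_sub]
  constructor <;> intro h <;> nlinarith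

lemma convex_O (W : Finset (ℝ × ℝ)) (ρ : ℝ) (w) : Convex ℝ (O W ρ w) := by
  have : O W ρ w = Qo ρ ∩ ⋂ w' ∈ W.filter (· ≠ w), {q | d2 q w < d2 q w'} := by
    ext q; simp [O]
  rw [this]
  refine Convex.inter ?_ (convex_iInter₂ fun w' _ => ?_)
  · rw [Qo_eq]; exact (convex_Ioo _ _).prod (convex_Ioo _ _)
  · simp only [d2_lt]
    exact convex_halfSpace_lt (dotL (w' - w)).isLinear _

lemma exists_cell {W : Finset (ℝ × ℝ)} {ρ : ℝ} (hW : W.Nonempty) {q} (hq : q ∈ Q ρ) :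
    ∃ w ∈ W, q ∈ C W ρ w := by
  obtain ⟨w, hw, h⟩ := W.exists_min_image (d2 q) hW
  exact ⟨w, hw, hq, h⟩

lemma sum_O {W : Finset (ℝ × ℝ)} {ρ : ℝ} (hρ : 0 < ρ) (hW : W.Nonempty) :
    ∑ j ∈ W, volume.real (O W ρ j) = ρ := by
  have hd : (↑W : Set (ℝ × ℝ)).PairwiseDisjoint (O W ρ) := by
    intro a ha b hb hab
    rw [Function.onFun, Set.disjoint_left]
    intro q hqa hqb
    exact hab (O_disj (Finset.mem_coe.mp ha) hqb (O_sub_C _ _ _ hqa) (Finset.mem_coe.mp hb))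
  rw [← measureReal_biUnion_finset hd (fun j _ => (isOpen_O W ρ j).measurableSet)
    (fun j _ => fin_sub (O_sub W ρ j))]
  set N : Set (ℝ × ℝ) := ⋃ w ∈ (W : Set (ℝ × ℝ)), ⋃ w' ∈ {x : ℝ × ℝ | x ∈ W ∧ x ≠ w},
      {q | d2 q w = d2 q w'} with hN
  have hN0 : volume N = 0 := by
    rw [hN, measure_biUnion_null_iff W.countable_toSet]
    intro w hw
    rw [measure_biUnion_null_iff (W.countable_toSet.mono fun x hx => hx.1)]
    intro w' hw'
    have hne : w' - w ≠ 0 := sub_ne_zero.mpr hw'.2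
    refine measure_mono_null ?_ (line_null hne ((dot w' w' - dot w w) / 2))
    intro q hq
    have hq : d2 q w = d2 q w' := hq
    show dot q (w' - w) = _
    simp only [d2, dot, Prod.fst_sub, Prod.snd_sub] at hq ⊢
    nlinarith
  have hsub : Qo ρ ⊆ (⋃ j ∈ W, O W ρ j) ∪ N := by
    intro q hq
    obtain ⟨w, hw, hC⟩ := exists_cell hW (Qo_sub ρ hq)
    by_cases h : q ∈ O W ρ w
    · exact Or.inl (mem_biUnion hw h)
    · right
      have : ∃ w' ∈ W, w' ≠ w ∧ d2 q w' ≤ d2 q w := by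
        by_contra hc; push Not at hc
        exact h ⟨hq, hc⟩
      obtain ⟨w', hw', hne, hle⟩ := this
      refine mem_biUnion (show w ∈ (W : Set _) from hw) ?_
      refine mem_biUnion (show w' ∈ {x : ℝ × ℝ | x ∈ W ∧ x ≠ w} from ⟨hw', hne⟩) ?_
      exact le_antisymm (hC.2 w' hw') hle
  have hUQ : (⋃ j ∈ W, O W ρ j) ⊆ Qo ρ := iUnion₂_subset fun j _ q hq => hq.1
  apply le_antisymm
  · exact (measureReal_mono hUQ (fin_sub (Qo_sub ρ))).trans (vol_Qo hρ).le
  · refine (vol_Qo hρ).symm.le.trans ?_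
    simp only [Measure.real]
    refine ENNReal.toReal_mono (fin_sub (hUQ.trans (Qo_sub ρ))) ?_
    calc volume (Qo ρ) ≤ _ := measure_mono hsub
      _ ≤ _ := measure_union_le _ _
      _ = _ := by rw [hN0, add_zero]

lemma hf_add (W : Finset (ℝ × ℝ)) (ρ : ℝ) (w) {u : ℝ × ℝ} (hu : u ≠ 0) :
    volume.real (Hf W ρ w u) + volume.real (Hf W ρ w (-u)) = volume.real (O W ρ w) := by
  have hd : Disjoint (Hf W ρ w u) (Hf W ρ w (-u)) := by
    rw [Set.disjoint_left]
    intro q h1 h2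
    have := h1.2
    have := h2.2
    rw [dot_neg_right] at this
    linarith
  rw [← measureReal_union hd (isOpen_Hf _ _ _ _).measurableSet
    (fin_sub ((Hf_sub _ _ _ _).trans (O_sub W ρ w)))
    (fin_sub ((Hf_sub _ _ _ _).trans (O_sub W ρ w)))]
  have hU : Hf W ρ w u ∪ Hf W ρ w (-u) ⊆ O W ρ w :=
    union_subset (Hf_sub _ _ _ _) (Hf_sub _ _ _ _)
  apply le_antisymm
  · exact measureReal_mono hU (fin_sub (O_sub W ρ w))
  · simp only [Measure.real]
    refine ENNReal.toReal_mono (fin_sub (hU.trans (O_sub W ρ w))) ?_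
    calc volume (O W ρ w) ≤ volume (Hf W ρ w u ∪ Hf W ρ w (-u) ∪ {q | dot q u = dot w u}) := by
          apply measure_mono
          intro q hq
          rcases lt_trichotomy (dot (q - w) u) 0 with h | h | h
          · left; right
            exact ⟨hq, by rw [dot_neg_right]; linarith⟩
          · right
            rw [dot_sub_left] at h
            show dot q u = dot w u
            linarith
          · left; left; exact ⟨hq, h⟩
      _ ≤ _ := measure_union_le _ _
      _ = _ := by rw [line_null hu, add_zero]

def Feas (ρ : ℝ) (w u : ℝ × ℝ) : Prop := ∀ᶠ δ in 𝓝[>] (0:ℝ), w + δ • u ∈ Q ρ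

lemma claim_pt {W : Finset (ℝ × ℝ)} {ρ : ℝ} {w u q} (hq : q ∈ Hf W ρ w u) :
    ∀ᶠ δ in 𝓝[>] (0:ℝ), ∀ w' ∈ W, d2 q (w + δ • u) < d2 q w' := by
  have hc : Tendsto (fun δ : ℝ => 2 * dot (q - w) u - δ * dot u u) (𝓝[>] 0)
      (𝓝 (2 * dot (q - w) u - 0 * dot u u)) := by
    apply Tendsto.mono_left _ nhdsWithin_le_nhds
    apply Continuous.tendsto
    fun_prop
  have h0 : 0 < 2 * dot (q - w) u - 0 * dot u u := by
    have := hq.2; linarith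
  filter_upwards [hc.eventually_const_lt h0, self_mem_nhdsWithin] with δ h1 h2 w' hw'
  refine lt_of_lt_of_le ?_ ((O_sub_C W ρ w hq.1).2 w' hw')
  have h2 : 0 < δ := h2
  have := mul_pos h2 h1
  simp only [d2, dot, Prod.fst_add, Prod.snd_add, Prod.smul_fst, Prod.smul_snd, smul_eq_mul,
    Prod.fst_sub, Prod.snd_sub] at this ⊢
  nlinarith

lemma key {W : Finset (ℝ × ℝ)} {ρ : ℝ} (hρ : 0 < ρ) (hnw : ¬ Win W ρ) {s : ℝ × ℝ} (hs : s ∈ W)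
    (bs : ℝ → ℝ × ℝ) {V : Set (ℝ × ℝ)} (hVm : MeasurableSet V) (hVQ : V ⊆ Q ρ)
    (hbs : ∀ᶠ δ in 𝓝[>] (0:ℝ), bs δ ∈ Q ρ)
    (hV : ∀ q ∈ V, ∀ᶠ δ in 𝓝[>] (0:ℝ), ∀ w ∈ W, d2 q (bs δ) < d2 q w)
    (u : ℝ × ℝ → ℝ × ℝ) (hu : ∀ j ∈ W, j ≠ s → Feas ρ j (u j))
    (hh : ∀ j ∈ W, j ≠ s → volume.real (O W ρ j) / 2 ≤ volume.real (Hf W ρ j (u j)))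
    (hdis : ∀ j ∈ W, j ≠ s → Disjoint V (Hf W ρ j (u j))) :
    volume.real V ≤ volume.real (O W ρ s) / 2 := by
  by_contra hlt
  push Not at hlt
  apply hnw
  classical
  have hHQ : ∀ j, Hf W ρ j (u j) ⊆ Q ρ := fun j => (Hf_sub _ _ _ _).trans (O_sub W ρ j)
  refine win_of hρ (fun j δ => if j = s then bs δ else j + δ • u j)
    (fun j => if j = s then V else Hf W ρ j (u j)) ?_ ?_ ?_ ?_ ?_ ?_
  · intro j hj
    by_cases e : j = s
    · simpa [e] using hVm
    · simpa [e] using (isOpen_Hf _ _ _ _).measurableSet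
  · intro j hj
    by_cases e : j = s
    · simpa [e] using hVQ
    · simpa [e] using hHQ j
  · intro a ha b hb hab
    have ha : a ∈ W := ha
    have hb : b ∈ W := hb
    rw [Function.onFun]
    by_cases ea : a = s
    · have eb : b ≠ s := fun h => hab (ea.trans h.symm)
      simpa [ea, eb] using hdis b hb eb
    · by_cases eb : b = s
      · simpa [ea, eb] using (hdis a ha ea).symm
      · simp only [ea, eb, if_false]
        rw [Set.disjoint_left]
        intro q hqa hqb
        exact hab (O_disj ha hqb.1 (O_sub_C _ _ _ hqa.1) hb)
  · intro j hj
    by_cases e : j = s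
    · simpa [e] using hbs
    · simpa [e, Feas] using hu j hj e
  · intro j hj q hq
    by_cases e : j = s
    · simp only [e, if_true] at hq ⊢
      exact hV q hq
    · simp only [e, if_false] at hq ⊢
      exact claim_pt hq
  · have h1 := sum_O hρ ⟨s, hs⟩
    rw [← Finset.add_sum_erase W _ hs] at h1 ⊢
    simp only [if_true]
    have h2 : ∑ j ∈ W.erase s, volume.real (O W ρ j) / 2 ≤
        ∑ j ∈ W.erase s, volume.real (if j = s then V else Hf W ρ j (u j)) := by
      apply Finset.sum_le_sum
      intro j hj
      obtain ⟨h3, h4⟩ := Finset.mem_erase.mp hj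
      simpa [h3] using hh j h4 h3
    rw [← Finset.sum_div] at h2
    linarith

lemma feas_of {ρ : ℝ} {w : ℝ × ℝ} (hw : w ∈ Q ρ) (u : ℝ × ℝ) {δ0 : ℝ} (h0 : 0 < δ0)
    (h : w + δ0 • u ∈ Q ρ) : Feas ρ w u := by
  filter_upwards [Ioo_mem_nhdsGT h0] with δ hδ
  have hc : Convex ℝ (Q ρ) := by rw [Q_eq]; exact (convex_Icc _ _).prod (convex_Icc _ _)
  have h3 : 0 < δ / δ0 := div_pos hδ.1 h0
  have h4 : δ / δ0 ≤ 1 := (div_le_one h0).mpr hδ.2.le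
  have := hc hw h (a := 1 - δ / δ0) (b := δ / δ0) (by linarith) h3.le (by ring)
  convert this using 1
  rw [smul_add, smul_smul, div_mul_cancel₀ _ h0.ne', ← add_assoc, ← add_smul]
  simp

lemma feas_int {ρ : ℝ} {w : ℝ × ℝ} (hw : w ∈ Qo ρ) (u : ℝ × ℝ) : Feas ρ w u := by
  have : ∀ᶠ δ in 𝓝 (0:ℝ), w + δ • u ∈ Qo ρ := by
    have hc : Continuous fun δ : ℝ => w + δ • u := by fun_prop
    exact hc.continuousAt.eventually_mem ((isOpen_Qo ρ).mem_nhds (by simpa using hw))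
  exact (this.filter_mono nhdsWithin_le_nhds).mono fun δ h => Qo_sub ρ h

lemma Hf_full {W : Finset (ℝ × ℝ)} {ρ : ℝ} {w u : ℝ × ℝ} (h : ∀ q ∈ Qo ρ, 0 < dot (q - w) u) :
    Hf W ρ w u = O W ρ w :=
  subset_antisymm (Hf_sub _ _ _ _) fun q hq => ⟨hq, h q hq.1⟩

lemma good_dir {W : Finset (ℝ × ℝ)} {ρ : ℝ} {w} (hw : w ∈ Q ρ) :
    ∃ u, Feas ρ w u ∧ volume.real (O W ρ w) / 2 ≤ volume.real (Hf W ρ w u) := by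
  obtain ⟨h1, h2, h3, h4⟩ := hw
  have hp : 0 ≤ volume.real (O W ρ w) := measureReal_nonneg
  rcases h1.eq_or_lt with h | h1'
  · refine ⟨(1, 0), feas_of ⟨h1, h2, h3, h4⟩ _ one_pos ?_, ?_⟩
    · simp [Q, ← h, h3, h4]
    · rw [Hf_full]
      · linarith
      · intro q hq; simp [dot, ← h]; exact hq.1
  rcases h2.eq_or_lt with h | h2'
  · refine ⟨(-1, 0), feas_of ⟨h1, h2, h3, h4⟩ _ one_pos ?_, ?_⟩
    · simp [Q, h, h3, h4]
    · rw [Hf_full]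
      · linarith
      · intro q hq; simp [dot, h]; exact hq.2.1
  have hadd := hf_add W ρ w (u := (1, 0)) (by simp)
  have f1 : Feas ρ w (1, 0) := feas_of ⟨h1, h2, h3, h4⟩ _ (sub_pos.mpr h2')
    (by simp [Q, h3, h4])
  have f2 : Feas ρ w (-(1, 0)) := feas_of ⟨h1, h2, h3, h4⟩ _ h1' (by simp [Q, h3, h4])
  rcases le_total (volume.real (O W ρ w) / 2) (volume.real (Hf W ρ w (1, 0))) with h | h
  · exact ⟨_, f1, h⟩
  · exact ⟨_, f2, by linarith⟩

lemma half_le {W : Finset (ℝ × ℝ)} {ρ : ℝ} (hρ : 0 < ρ) (hnw : ¬ Win W ρ) (hWQ : ↑W ⊆ Q ρ)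
    {s : ℝ × ℝ} (hs : s ∈ W) {u : ℝ × ℝ} (hf : Feas ρ s u) :
    volume.real (Hf W ρ s u) ≤ volume.real (O W ρ s) / 2 := by
  have : ∀ j, ∃ u, j ∈ W → Feas ρ j u ∧ volume.real (O W ρ j) / 2 ≤ volume.real (Hf W ρ j u) := by
    intro j
    by_cases hj : j ∈ W
    · obtain ⟨u, hu⟩ := good_dir (W := W) (hWQ hj)
      exact ⟨u, fun _ => hu⟩
    · exact ⟨0, fun h => absurd h hj⟩
  choose u' hu' using this
  refine key hρ hnw hs (fun δ => s + δ • u) (isOpen_Hf _ _ _ _).measurableSet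
    ((Hf_sub _ _ _ _).trans (O_sub _ _ _)) hf (fun q hq => claim_pt hq) u'
    (fun j hj _ => (hu' j hj).1) (fun j hj _ => (hu' j hj).2) ?_
  intro j hj hne
  rw [Set.disjoint_left]
  intro q hqa hqb
  exact hne (O_disj hs hqb.1 (O_sub_C _ _ _ hqa.1) hj).symm

lemma O_pos {W : Finset (ℝ × ℝ)} {ρ : ℝ} (hρ : 0 < ρ) {w} (hw : w ∈ Q ρ) :
    0 < volume.real (O W ρ w) := by
  have hne : (O W ρ w).Nonempty := by
    set c : ℝ × ℝ := (1/2, ρ/2) with hc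
    have h : ∀ᶠ τ in 𝓝[>] (0:ℝ), w + τ • (c - w) ∈ O W ρ w := by
      have hcont : Continuous fun δ : ℝ => w + δ • (c - w) := by fun_prop
      have h1 : ∀ᶠ τ in 𝓝[>] (0:ℝ), ∀ w' ∈ W, w' ≠ w →
          d2 (w + τ • (c - w)) w < d2 (w + τ • (c - w)) w' := by
        rw [eventually_all_finset]
        intro w' hw'
        by_cases e : w' = w
        · simp [e]
        · have := (isOpen_lt ((cont_d2 w).comp hcont) ((cont_d2 w').comp hcont)).mem_nhds
            (x := (0:ℝ)) (by
              simp only [mem_ofPred_eq, Function.comp, zero_smul, add_zero]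
              have := dot_self_pos (sub_ne_zero.mpr e)
              simp only [d2, dot, Prod.fst_sub, Prod.snd_sub] at this ⊢
              nlinarith)
          filter_upwards [mem_nhdsWithin_of_mem_nhds this] with τ h _ using h
      filter_upwards [h1, Ioo_mem_nhdsGT (zero_lt_one' ℝ)] with τ h2 h3
      refine ⟨?_, h2⟩
      obtain ⟨a1, a2, a3, a4⟩ := hw
      obtain ⟨b1, b2⟩ := h3
      simp only [Qo, mem_ofPred_eq, hc, Prod.fst_add, Prod.snd_add, Prod.smul_fst, Prod.smul_snd,
        smul_eq_mul, Prod.fst_sub, Prod.snd_sub]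
      refine ⟨?_, ?_, ?_, ?_⟩ <;> nlinarith [mul_pos b1 hρ]
    obtain ⟨τ, h⟩ := h.exists
    exact ⟨_, h⟩
  have := (isOpen_O W ρ w).measure_pos volume hne
  exact ENNReal.toReal_pos this.ne' (fin_sub (O_sub W ρ w))

lemma interior {W : Finset (ℝ × ℝ)} {ρ : ℝ} (hρ : 0 < ρ) (hnw : ¬ Win W ρ) (hWQ : ↑W ⊆ Q ρ)
    {s : ℝ × ℝ} (hs : s ∈ W) : s ∈ Qo ρ := by
  have hQ : s ∈ Q ρ := hWQ hs
  have hp := O_pos (W := W) hρ hQ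
  have main : ∀ u, s + u ∈ Q ρ → (∀ q ∈ Qo ρ, 0 < dot (q - s) u) → False := by
    intro u h1 h2
    have := half_le hρ hnw hWQ hs (u := u) (feas_of hQ u one_pos (by simpa using h1))
    rw [Hf_full h2] at this
    linarith
  obtain ⟨h1, h2, h3, h4⟩ := hQ
  refine ⟨lt_of_le_of_ne h1 fun h => ?_, lt_of_le_of_ne h2 fun h => ?_,
    lt_of_le_of_ne h3 fun h => ?_, lt_of_le_of_ne h4 fun h => ?_⟩
  · refine main (1, 0) (by simp [Q, ← h, h3, h4]) fun q hq => ?_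
    simp [dot, ← h]; exact hq.1
  · refine main (-1, 0) (by simp [Q, h, h3, h4]) fun q hq => ?_
    simp [dot, h]; exact hq.2.1
  · refine main (0, ρ) (by simp [Q, ← h, h1, h2, hρ.le]) fun q hq => ?_
    simp [dot, ← h]; exact mul_pos hq.2.2.1 hρ
  · refine main (0, -ρ) (by simp [Q, h, h1, h2, hρ.le]) fun q hq => ?_
    simp [dot, h]; nlinarith [hq.2.2.2]

end VG

namespace VG
open Filter Topology

lemma sym_lemma {S : Set (ℝ × ℝ)} (hSo : IsOpen S) (hSc : Convex ℝ S) (h0 : (0 : ℝ × ℝ) ∈ S)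
    (hfin : volume S ≠ ⊤)
    (hh : ∀ u : ℝ × ℝ, u ≠ 0 → volume.real (S ∩ {q | 0 < dot q u}) ≤ volume.real S / 2)
    {x : ℝ × ℝ} (hx : x ∈ S) : -x ∈ S := by
  by_contra hnx
  obtain ⟨f, hf⟩ := geometric_hahn_banach_open_point hSc hSo hnx
  have hx0 : x ≠ 0 := by rintro rfl; simp at hnx; exact hnx h0
  set k := f (-x) with hk
  have hkpos : 0 < k := by simpa using hf 0 h0
  have hfx : f x = -k := by simp [hk]
  set J : ℝ × ℝ := (-x.2, x.1) with hJ
  have hn := dot_self_pos hx0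
  obtain ⟨e0, he0, hball⟩ : ∃ e0 > 0, ∀ a c : ℝ, |a - 1| < e0 → |c| < e0 → a • x + c • J ∈ S := by
    have hc : Continuous fun p : ℝ × ℝ => p.1 • x + p.2 • J := by fun_prop
    have hmem : (fun p : ℝ × ℝ => p.1 • x + p.2 • J) ⁻¹' S ∈ 𝓝 ((1, 0) : ℝ × ℝ) :=
      (hSo.preimage hc).mem_nhds (by simpa using hx)
    obtain ⟨e0, he0, h⟩ := Metric.mem_nhds_iff.mp hmem
    refine ⟨e0, he0, fun a c h1 h2 => @h (a, c) ?_⟩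
    rw [Metric.mem_ball, Prod.dist_eq, max_lt_iff]
    simpa [Real.dist_eq] using And.intro h1 h2
  set l := 1 + e0 / 2 with hl
  have hl1 : 1 < l := by linarith
  set F := |f J| with hF
  have hF0 : 0 ≤ F := abs_nonneg _
  obtain ⟨ε, hε, hε1, hε2, hε3⟩ : ∃ ε > 0, l * ε < e0 ∧ k ≤ l * (k - ε * F) ∧ 0 < k - ε * F := by
    refine ⟨min (e0 / (2 * l)) (k * (l - 1) / (l * (F + 1))), ?_, ?_, ?_, ?_⟩
    · have : 0 < l - 1 := by linarith
      positivity
    all_goals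
      set ε := min (e0 / (2 * l)) (k * (l - 1) / (l * (F + 1)))
      have hl0 : 0 < l := by linarith
      have A : ε * (2 * l) ≤ e0 := by
        have := min_le_left (e0 / (2 * l)) (k * (l - 1) / (l * (F + 1)))
        rwa [le_div_iff₀ (by positivity)] at this
      have B : ε * (l * (F + 1)) ≤ k * (l - 1) := by
        have := min_le_right (e0 / (2 * l)) (k * (l - 1) / (l * (F + 1)))
        rwa [le_div_iff₀ (by positivity)] at this
      have hε : 0 < ε := by
        have : 0 < l - 1 := by linarith
        positivity
      have D : l * (ε * F) ≤ k * (l - 1) := by nlinarith [mul_pos hl0 hε]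
    · nlinarith
    · nlinarith
    · have : l * (ε * F) < l * k := by nlinarith
      have := lt_of_mul_lt_mul_left this hl0.le
      linarith
  set u1 : ℝ × ℝ := ε • x + J with hu1
  set u2 : ℝ × ℝ := ε • x - J with hu2
  -- coordinates
  let ca : ℝ × ℝ → ℝ := fun q => dot q x / dot x x
  let cc : ℝ × ℝ → ℝ := fun q => dot q J / dot x x
  have hdec : ∀ q, q = ca q • x + cc q • J := by
    intro q
    have hn' : x.1 * x.1 + x.2 * x.2 ≠ 0 := hn.ne'
    have hn2 : x.1 ^ 2 + x.2 ^ 2 ≠ 0 := by convert hn' using 1; ring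
    have hn3 : x.2 ^ 2 + x.1 ^ 2 ≠ 0 := by convert hn' using 1; ring
    apply Prod.ext <;> simp [ca, cc, hJ, dot] <;> field_simp <;> ring
  have hd1 : ∀ q, dot q u1 = dot x x * (ε * ca q + cc q) := by
    intro q
    have : dot q u1 = ε * dot q x + dot q J := by simp [hu1, dot]; ring
    rw [this]; simp only [ca, cc]; field_simp
  have hd2 : ∀ q, dot q u2 = dot x x * (ε * ca q - cc q) := by
    intro q
    have : dot q u2 = ε * dot q x - dot q J := by simp [hu2, dot]; ring
    rw [this]; simp only [ca, cc]; field_simp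
  have hcax : ca x = 1 := by simp only [ca]; field_simp
  have hccx : cc x = 0 := by simp [cc, hJ, dot]; left; ring
  have hu1n : u1 ≠ 0 := by
    intro h
    have := hd1 x
    rw [h, hcax, hccx] at this
    have h2 := mul_pos hn hε
    have h3 : dot x 0 = 0 := by simp [dot]
    rw [h3] at this
    nlinarith
  have hu2n : u2 ≠ 0 := by
    intro h
    have := hd2 x
    rw [h, hcax, hccx] at this
    have h2 := mul_pos hn hε
    have h3 : dot x 0 = 0 := by simp [dot]
    rw [h3] at this
    nlinarith
  set P1 : Set (ℝ × ℝ) := {q | 0 < dot q u1} with hP1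
  set P2 : Set (ℝ × ℝ) := {q | 0 < dot q u2} with hP2
  have hDab : ∀ q, q ∈ P1 ∩ P2 → 0 < ca q ∧ |cc q| < ε * ca q := by
    rintro q ⟨h1, h2⟩
    have h1 : 0 < dot q u1 := h1
    have h2 : 0 < dot q u2 := h2
    rw [hd1] at h1; rw [hd2] at h2
    have h1 := pos_of_mul_pos_right h1 hn.le
    have h2 := pos_of_mul_pos_right h2 hn.le
    refine ⟨?_, abs_lt.mpr ⟨by linarith, by linarith⟩⟩
    nlinarith
  have oP1 : IsOpen P1 := isOpen_lt continuous_const (cont_dot u1)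
  have oP2 : IsOpen P2 := isOpen_lt continuous_const (cont_dot u2)
  -- claim A
  have hA : ∀ q, q ∈ P1 ∩ P2 → -q ∈ S → q ∈ S ∧ ca q < l := by
    intro q hq hqs
    obtain ⟨h1, h2⟩ := hDab q hq
    have hfq := hf _ hqs
    have e1 : f (-q) = ca q * k - cc q * f J := by
      conv_lhs => rw [hdec q]
      simp only [map_neg, map_add, map_smul, hfx, smul_eq_mul]; ring
    rw [e1] at hfq
    have h3 : cc q * f J ≤ ε * ca q * F := by
      calc cc q * f J ≤ |cc q * f J| := le_abs_self _
        _ = |cc q| * F := abs_mul _ _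
        _ ≤ _ := by gcongr
    have h4 : ca q < l := by
      have : (k - ε * F) * ca q < (k - ε * F) * l := by nlinarith
      exact lt_of_mul_lt_mul_left this hε3.le
    refine ⟨?_, h4⟩
    have hl0 : 0 < l := by linarith
    have hm : l • x + (l * cc q / ca q) • J ∈ S := by
      apply hball
      · rw [hl, add_sub_cancel_left, abs_of_pos (by linarith)]; linarith
      · rw [abs_div, abs_mul, abs_of_pos hl0, abs_of_pos h1, div_lt_iff₀ h1]
        nlinarith
    have := hSc.smul_mem_of_zero_mem h0 hm (t := ca q / l)
      ⟨(div_pos h1 hl0).le, ((div_lt_one hl0).mpr h4).le⟩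
    convert this using 1
    conv_lhs => rw [hdec q]
    rw [smul_add, smul_smul, smul_smul]
    congr 2 <;> field_simp
  set G : Set (ℝ × ℝ) := S ∩ (P1 ∩ P2) ∩ {q | l < ca q} with hG
  have hcac : Continuous ca := (cont_dot x).div_const _
  have oG : IsOpen G := (hSo.inter (oP1.inter oP2)).inter (isOpen_lt continuous_const hcac)
  have hGne : G.Nonempty := by
    refine ⟨(1 + 3 * e0 / 4) • x, ⟨?_, ?_, ?_⟩, ?_⟩
    · have := hball (1 + 3 * e0 / 4) 0 (by
        rw [add_sub_cancel_left, abs_of_pos (by linarith)]; linarith) (by simpa using he0)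
      simpa using this
    · show 0 < dot _ u1
      have : dot ((1 + 3 * e0 / 4) • x) u1 = (1 + 3 * e0 / 4) * dot x u1 := by simp [dot]; ring
      rw [this, hd1, hcax, hccx]
      have : 0 < 1 + 3 * e0 / 4 := by linarith
      have : 0 < ε * 1 + 0 := by linarith
      positivity
    · show 0 < dot _ u2
      have : dot ((1 + 3 * e0 / 4) • x) u2 = (1 + 3 * e0 / 4) * dot x u2 := by simp [dot]; ring
      rw [this, hd2, hcax, hccx]
      have : 0 < 1 + 3 * e0 / 4 := by linarith
      have : 0 < ε * 1 - 0 := by linarith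
      positivity
    · show l < ca _
      have : ca ((1 + 3 * e0 / 4) • x) = (1 + 3 * e0 / 4) * ca x := by simp [ca, dot]; ring
      rw [this, hcax]; linarith
  have fS : ∀ {T : Set (ℝ × ℝ)}, T ⊆ S → volume T ≠ ⊤ := fun h => measure_ne_top_of_subset h hfin
  have hGpos : 0 < volume.real G :=
    ENNReal.toReal_pos (oG.measure_pos volume hGne).ne' (fS fun q hq => hq.1.1)
  -- measures
  set N1 : Set (ℝ × ℝ) := S ∩ {q | dot q u1 < 0 ∧ dot q u2 < 0} with hN1
  have oN1 : IsOpen N1 := hSo.inter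
    ((isOpen_lt (cont_dot u1) continuous_const).inter (isOpen_lt (cont_dot u2) continuous_const))
  have hneg : volume.real (-N1) = volume.real N1 := by
    simp [Measure.real]
  have hge : volume.real N1 + volume.real G ≤ volume.real (S ∩ (P1 ∩ P2)) := by
    have hmem : ∀ q, q ∈ -N1 → -q ∈ S ∧ q ∈ P1 ∩ P2 := by
      intro q hq
      obtain ⟨h1, h2, h3⟩ : -q ∈ S ∧ dot (-q) u1 < 0 ∧ dot (-q) u2 < 0 := hq
      rw [dot_neg_left] at h2 h3
      exact ⟨h1, show 0 < dot q u1 by linarith, show 0 < dot q u2 by linarith⟩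
    have hNS : -N1 ⊆ S ∩ (P1 ∩ P2) := fun q hq =>
      ⟨(hA q (hmem q hq).2 (hmem q hq).1).1, (hmem q hq).2⟩
    rw [← hneg, ← measureReal_union (h₁ := fS (hNS.trans inter_subset_left))
      (h₂ := fS fun q hq => hq.1.1)]
    · exact measureReal_mono (union_subset hNS inter_subset_left) (fS inter_subset_left)
    · rw [Set.disjoint_left]
      intro q h1 h2
      have := (hA q (hmem q h1).2 (hmem q h1).1).2
      have h3 : l < ca q := h2.2
      linarith
    · exact oG.measurableSet
  have m1 := measureReal_inter_add_sdiff (μ := volume) (s := S ∩ P1) oP2.measurableSet (fS inter_subset_left)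
  have m2 := measureReal_inter_add_sdiff (μ := volume) (s := S ∩ P2) oP1.measurableSet (fS inter_subset_left)
  have m3 := measureReal_inter_add_sdiff (μ := volume) (s := S) oP1.measurableSet hfin
  have m4 := measureReal_inter_add_sdiff (μ := volume) (s := S \ P1) oP2.measurableSet (fS sdiff_subset)
  have e1 : S ∩ P1 ∩ P2 = S ∩ (P1 ∩ P2) := inter_assoc _ _ _
  have e2 : S ∩ P2 ∩ P1 = S ∩ (P1 ∩ P2) := by rw [inter_assoc, inter_comm P2]
  have e3 : S \ P1 ∩ P2 = (S ∩ P2) \ P1 := by ext q; simp only [mem_inter_iff, Set.mem_sdiff]; tauto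
  have m5 : volume.real ((S \ P1) \ P2) ≤ volume.real N1 := by
    simp only [Measure.real]
    refine ENNReal.toReal_mono (fS inter_subset_left) ?_
    calc volume ((S \ P1) \ P2) ≤ volume (N1 ∪ {q | dot q u1 = 0} ∪ {q | dot q u2 = 0}) := by
          apply measure_mono
          rintro q ⟨⟨h1, h2⟩, h3⟩
          have h2 : dot q u1 ≤ 0 := not_lt.mp h2
          have h3 : dot q u2 ≤ 0 := not_lt.mp h3
          rcases h2.eq_or_lt with h2 | h2
          · exact Or.inl (Or.inr h2)
          rcases h3.eq_or_lt with h3 | h3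
          · exact Or.inr h3
          · exact Or.inl (Or.inl ⟨h1, h2, h3⟩)
      _ ≤ volume (N1 ∪ {q | dot q u1 = 0}) + volume {q | dot q u2 = 0} := measure_union_le _ _
      _ ≤ volume N1 + volume {q | dot q u1 = 0} + volume {q | dot q u2 = 0} := by
          gcongr; exact measure_union_le _ _
      _ = _ := by rw [line_null hu1n, line_null hu2n]; simp
  have k1 := hh u1 hu1n
  have k2 := hh u2 hu2n
  rw [e1] at m1; rw [e2] at m2; rw [e3] at m4
  linarith

lemma O_sym {W : Finset (ℝ × ℝ)} {ρ : ℝ} (hρ : 0 < ρ) (hnw : ¬ Win W ρ) (hWQ : ↑W ⊆ Q ρ)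
    {s : ℝ × ℝ} (hs : s ∈ W) {v : ℝ × ℝ} (hv : s + v ∈ O W ρ s) : s - v ∈ O W ρ s := by
  have hint := interior hρ hnw hWQ hs
  have htr : ∀ T : Set (ℝ × ℝ), volume.real ((fun q => s + q) ⁻¹' T) = volume.real T := by
    intro T; simp [Measure.real]
  have hc : Continuous fun q : ℝ × ℝ => s + q := by fun_prop
  have := sym_lemma (S := (fun q => s + q) ⁻¹' (O W ρ s)) ((isOpen_O W ρ s).preimage hc) ?_ ?_ ?_ ?_
    (x := v) hv
  · simpa [sub_eq_add_neg] using this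
  · exact (convex_O W ρ s).translate_preimage_right s
  · simp only [mem_preimage, add_zero]
    refine ⟨hint, fun w' _ hne => ?_⟩
    have := dot_self_pos (sub_ne_zero.mpr hne)
    simp only [d2, dot, Prod.fst_sub, Prod.snd_sub] at this ⊢
    nlinarith
  · rw [measure_preimage_add]
    exact fin_sub (O_sub W ρ s)
  · intro u hu
    rw [htr]
    have : (fun q => s + q) ⁻¹' (O W ρ s) ∩ {q | 0 < dot q u} = (fun q => s + q) ⁻¹' (Hf W ρ s u) := by
      ext q
      simp [Hf]
    rw [this, htr]
    exact half_le hρ hnw hWQ hs (feas_int hint u)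

lemma C_sym {W : Finset (ℝ × ℝ)} {ρ : ℝ} (hρ : 0 < ρ) (hnw : ¬ Win W ρ) (hWQ : ↑W ⊆ Q ρ)
    {s : ℝ × ℝ} (hs : s ∈ W) {v : ℝ × ℝ} (hv : s + v ∈ C W ρ s) : s - v ∈ C W ρ s := by
  have hint := interior hρ hnw hWQ hs
  have h1 : ∀ τ ∈ Ico (0:ℝ) 1, s - τ • v ∈ O W ρ s := by
    rintro τ ⟨h0, h1⟩
    apply O_sym hρ hnw hWQ hs
    constructor
    · obtain ⟨⟨a1, a2, a3, a4⟩, -⟩ := hv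
      obtain ⟨b1, b2, b3, b4⟩ := hint
      simp only [Qo, mem_ofPred_eq, Prod.fst_add, Prod.snd_add, Prod.smul_fst, Prod.smul_snd,
        smul_eq_mul] at *
      refine ⟨?_, ?_, ?_, ?_⟩ <;> nlinarith
    · intro w' hw' hne
      have := dot_self_pos (sub_ne_zero.mpr hne)
      have h2 := hv.2 w' hw'
      simp only [d2, dot, Prod.fst_add, Prod.snd_add, Prod.smul_fst, Prod.smul_snd,
        smul_eq_mul, Prod.fst_sub, Prod.snd_sub] at *
      nlinarith
  have h2 : IsClosed (C W ρ s) := by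
    have : C W ρ s = Q ρ ∩ ⋂ w' ∈ W, {q | d2 q s ≤ d2 q w'} := by ext q; simp [C]
    rw [this]
    refine IsClosed.inter ?_ (isClosed_biInter fun w' _ => isClosed_le (cont_d2 _) (cont_d2 _))
    rw [Q_eq]; exact isClosed_Icc.prod isClosed_Icc
  have hc : Continuous fun τ : ℝ => s - τ • v := by fun_prop
  have h3 : Tendsto (fun τ : ℝ => s - τ • v) (𝓝[<] 1) (𝓝 (s - (1:ℝ) • v)) :=
    hc.continuousAt.tendsto.mono_left nhdsWithin_le_nhds
  have := h2.mem_of_tendsto h3 (by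
    filter_upwards [Ioo_mem_nhdsLT (zero_lt_one' ℝ)] with τ hτ
    exact O_sub_C W ρ s (h1 τ ⟨hτ.1.le, hτ.2⟩))
  simpa using this

end VG

namespace VG
open Filter Topology

structure Sit (W : Finset (ℝ × ℝ)) (ρ : ℝ) : Prop where
  hρ : 0 < ρ
  int : ∀ w ∈ W, w ∈ Qo ρ
  sym : ∀ s ∈ W, ∀ v, s + v ∈ C W ρ s → s - v ∈ C W ρ s

lemma isClosed_C (W : Finset (ℝ × ℝ)) (ρ : ℝ) (s) : IsClosed (C W ρ s) := by
  have : C W ρ s = Q ρ ∩ ⋂ w' ∈ W, {q | d2 q s ≤ d2 q w'} := by ext q; simp [C]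
  rw [this]
  refine IsClosed.inter ?_ (isClosed_biInter fun w' _ => isClosed_le (cont_d2 _) (cont_d2 _))
  rw [Q_eq]; exact isClosed_Icc.prod isClosed_Icc

lemma tie {W : Finset (ℝ × ℝ)} {ρ : ℝ} {w q : ℝ × ℝ} (hq : q ∈ C W ρ w) (v : ℝ × ℝ)
    (hQ : ∀ᶠ ε in 𝓝[>] (0:ℝ), q + ε • v ∈ Q ρ) (hn : ∀ ε > (0:ℝ), q + ε • v ∉ C W ρ w) :
    ∃ w' ∈ W, d2 q w' = d2 q w ∧ 0 < dot v (w' - w) := by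
  by_contra hc
  push Not at hc
  have h1 : ∀ᶠ ε in 𝓝[>] (0:ℝ), ∀ w' ∈ W, d2 (q + ε • v) w ≤ d2 (q + ε • v) w' := by
    rw [eventually_all_finset]
    intro w' hw'
    have hle := hq.2 w' hw'
    rcases hle.eq_or_lt with h | h
    · have h2 := hc w' hw' h.symm
      filter_upwards [self_mem_nhdsWithin] with ε hε
      have hε : 0 < ε := hε
      rw [d2_le] at hle ⊢
      have : dot (q + ε • v) (w' - w) = dot q (w' - w) + ε * dot v (w' - w) := by
        simp [dot]; ring
      rw [this]
      nlinarith
    · have hcont : Continuous fun ε : ℝ => q + ε • v := by fun_prop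
      have := (isOpen_lt ((cont_d2 w).comp hcont) ((cont_d2 w').comp hcont)).mem_nhds
            (x := (0:ℝ)) (by simpa [Function.comp] using h)
      filter_upwards [mem_nhdsWithin_of_mem_nhds this] with τ h using le_of_lt h
  obtain ⟨ε, ⟨h2, h3⟩, h4⟩ := ((h1.and hQ).and self_mem_nhdsWithin).exists
  exact hn ε h4 ⟨h3, h2⟩

lemma self_excl {W : Finset (ℝ × ℝ)} {ρ : ℝ} {w w'} (hw' : w' ∈ W) (h : w' ∈ C W ρ w) :
    w' = w := by
  by_contra e
  have := h.2 w' hw'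
  have h2 := dot_self_pos (sub_ne_zero.mpr e)
  simp only [d2, dot, Prod.fst_sub, Prod.snd_sub] at this h2
  nlinarith

def Rect (W : Finset (ℝ × ℝ)) (ρ : ℝ) (w : ℝ × ℝ) (α β : ℝ) : Prop :=
  ∀ q : ℝ × ℝ, |q.1 - w.1| ≤ α → |q.2 - w.2| ≤ β → q ∈ C W ρ w

lemma rect_lin {A B K α β x y : ℝ} (hx : |x| ≤ α) (hy : |y| ≤ β)
    (h1 : A * α + B * β ≤ K) (h2 : A * α - B * β ≤ K) (h3 : -(A * α) + B * β ≤ K)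
    (h4 : -(A * α) - B * β ≤ K) : A * x + B * y ≤ K := by
  obtain ⟨a1, a2⟩ := abs_le.mp hx
  obtain ⟨b1, b2⟩ := abs_le.mp hy
  rcases le_total 0 A with hA | hA <;> rcases le_total 0 B with hB | hB <;> nlinarith

lemma rect_of {W : Finset (ℝ × ℝ)} {ρ : ℝ} (S : Sit W ρ) {w} (hw : w ∈ W) {α β : ℝ}
    (h1 : (w.1 + α, w.2 - β) ∈ C W ρ w) (h2 : (w.1 - α, w.2 - β) ∈ C W ρ w) :
    Rect W ρ w α β := by
  have h3 : (w.1 - α, w.2 + β) ∈ C W ρ w := by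
    have := S.sym w hw (α, -β) (by convert h1 using 1; ext <;> simp [sub_eq_add_neg])
    convert this using 1; ext <;> simp
  have h4 : (w.1 + α, w.2 + β) ∈ C W ρ w := by
    have := S.sym w hw (-α, -β) (by convert h2 using 1; ext <;> simp [sub_eq_add_neg])
    convert this using 1; ext <;> simp
  intro q hx hy
  obtain ⟨a1, a2⟩ := abs_le.mp hx
  obtain ⟨b1, b2⟩ := abs_le.mp hy
  refine ⟨?_, ?_⟩
  · obtain ⟨p1, p2, p3, p4⟩ := h1.1
    obtain ⟨q1, q2, q3, q4⟩ := h2.1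
    obtain ⟨r1, r2, r3, r4⟩ := h3.1
    simp only at *
    refine ⟨?_, ?_, ?_, ?_⟩ <;> linarith
  · intro w' hw'
    have e1 := h1.2 w' hw'
    have e2 := h2.2 w' hw'
    have e3 := h3.2 w' hw'
    have e4 := h4.2 w' hw'
    rw [d2_le] at *
    have := rect_lin (A := (w' - w).1) (B := (w' - w).2)
      (K := (dot w' w' - dot w w) / 2 - dot w (w' - w)) hx hy
      (by simp only [dot] at *; linarith) (by simp only [dot] at *; linarith)
      (by simp only [dot] at *; linarith) (by simp only [dot] at *; linarith)
    simp only [dot] at *; linarith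

lemma row {W : Finset (ℝ × ℝ)} {ρ : ℝ} (S : Sit W ρ) {w} (hw : w ∈ W)
    (hmin : ∀ w' ∈ W, w.2 ≤ w'.2) :
    ∃ α > 0, Rect W ρ w α w.2 ∧ (w.1 + α = 1 ∨ (w.1 + 2 * α, w.2) ∈ W) ∧
      (w.1 - α = 0 ∨ (w.1 - 2 * α, w.2) ∈ W) := by
  obtain ⟨i1, i2, i3, i4⟩ := S.int w hw
  set T : Set ℝ := {x | (x, (0:ℝ)) ∈ C W ρ w} with hT
  have hTs : T ⊆ Icc 0 1 := fun x hx => ⟨hx.1.1, hx.1.2.1⟩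
  have hTc : IsCompact T := isCompact_Icc.of_isClosed_subset
    ((isClosed_C W ρ w).preimage (by fun_prop : Continuous fun x : ℝ => (x, (0:ℝ)))) hTs
  have hTa : w.1 ∈ T := by
    refine ⟨⟨i1.le, i2.le, le_rfl, S.hρ.le⟩, fun w' hw' => ?_⟩
    have := hmin w' hw'
    simp only [d2]
    nlinarith [sq_nonneg (w.1 - w'.1)]
  obtain ⟨r, hr, hrmax⟩ := hTc.exists_isGreatest ⟨_, hTa⟩
  obtain ⟨l, hl, hlmin⟩ := hTc.exists_isLeast ⟨_, hTa⟩
  have hr' : (r, (0:ℝ)) ∈ C W ρ w := hr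
  have hl' : (l, (0:ℝ)) ∈ C W ρ w := hl
  have hra : w.1 ≤ r := hrmax hTa
  have hla : l ≤ w.1 := hlmin hTa
  have hrs : (2 * w.1 - r, 2 * w.2) ∈ C W ρ w := by
    have := S.sym w hw (r - w.1, - w.2) (by convert hr' using 1; ext <;> simp)
    convert this using 1; ext <;> simp <;> ring
  have hls : (2 * w.1 - l, 2 * w.2) ∈ C W ρ w := by
    have := S.sym w hw (l - w.1, - w.2) (by convert hl' using 1; ext <;> simp)
    convert this using 1; ext <;> simp <;> ring
  have R : r = 1 ∨ ∃ w' ∈ W, d2 (r, 0) w' = d2 (r, 0) w ∧ w.1 < w'.1 := by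
    by_cases h1 : r = 1
    · exact Or.inl h1
    right
    have hr1 : r < 1 := lt_of_le_of_ne (hTs hr).2 h1
    obtain ⟨w', hw', h2, h3⟩ := tie hr' (1, 0) (by
      filter_upwards [Ioo_mem_nhdsGT (sub_pos.mpr hr1)] with ε hε
      have := hε.1; have := hε.2; have := (hTs hr).1; have := S.hρ
      simp only [Q, mem_ofPred_eq, Prod.fst_add, Prod.snd_add, Prod.smul_fst, Prod.smul_snd,
        smul_eq_mul]
      refine ⟨?_, ?_, ?_, ?_⟩ <;> linarith) (by
      intro ε hε h
      have : r + ε ∈ T := by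
        show (r + ε, (0:ℝ)) ∈ C W ρ w
        convert h using 1; ext <;> simp
      have := hrmax this
      linarith)
    exact ⟨w', hw', h2, by simpa [dot] using h3⟩
  have L : l = 0 ∨ ∃ w' ∈ W, d2 (l, 0) w' = d2 (l, 0) w ∧ w'.1 < w.1 := by
    by_cases h1 : l = 0
    · exact Or.inl h1
    right
    have hl1 : 0 < l := lt_of_le_of_ne (hTs hl).1 (Ne.symm h1)
    obtain ⟨w', hw', h2, h3⟩ := tie hl' (-1, 0) (by
      filter_upwards [Ioo_mem_nhdsGT hl1] with ε hε
      have := hε.1; have := hε.2; have := (hTs hl).2; have := S.hρ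
      simp only [Q, mem_ofPred_eq, Prod.fst_add, Prod.snd_add, Prod.smul_fst, Prod.smul_snd,
        smul_eq_mul]
      refine ⟨?_, ?_, ?_, ?_⟩ <;> linarith) (by
      intro ε hε h
      have : l - ε ∈ T := by
        show (l - ε, (0:ℝ)) ∈ C W ρ w
        convert h using 1; ext <;> simp [sub_eq_add_neg]
      have := hlmin this
      linarith)
    exact ⟨w', hw', h2, by simpa [dot] using h3⟩
  have R2 : w.1 - l ≤ r - w.1 ∧ w.1 < r ∧
      (r = 1 ∨ (r - w.1 ≤ w.1 - l → (2 * r - w.1, w.2) ∈ W)) := by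
    rcases R with h | ⟨w', hw', h1, h2⟩
    · refine ⟨?_, by linarith, Or.inl h⟩
      have := hls.1.2.1
      simp only at this
      linarith
    · have h3 := hls.2 w' hw'
      have h4 := hmin w' hw'
      simp only [d2] at h1 h3
      have hp : 0 < w'.1 - w.1 := by linarith
      have hq : 0 ≤ w'.2 - w.2 := by linarith
      have hb := mul_nonneg hq i3.le
      have k1 : (w'.1 - w.1) * (w.1 - l) + 2 * ((w'.2 - w.2) * w.2) ≤ (w'.1 - w.1) * (r - w.1) := by
        nlinarith
      have k2 : 0 < (w'.1 - w.1) * (r - w.1) := by nlinarith [mul_pos hp hp]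
      have k3 := pos_of_mul_pos_right k2 hp.le
      refine ⟨le_of_mul_le_mul_left (by linarith) hp, by linarith, Or.inr fun h5 => ?_⟩
      have k4 := mul_le_mul_of_nonneg_left h5 hp.le
      have k5 : (w'.2 - w.2) * w.2 = 0 := by linarith
      have k6 : w'.2 = w.2 := by
        rcases mul_eq_zero.mp k5 with h | h <;> linarith
      have k7 : w'.1 = 2 * r - w.1 := by
        rw [k6] at h1
        have : (w'.1 - w.1) * (w'.1 - (2 * r - w.1)) = 0 := by nlinarith
        rcases mul_eq_zero.mp this with h | h <;> linarith
      rw [← k7, ← k6]; exact hw'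
  have L2 : r - w.1 ≤ w.1 - l ∧ l < w.1 ∧
      (l = 0 ∨ (w.1 - l ≤ r - w.1 → (2 * l - w.1, w.2) ∈ W)) := by
    rcases L with h | ⟨w', hw', h1, h2⟩
    · refine ⟨?_, by linarith, Or.inl h⟩
      have := hrs.1.1
      simp only at this
      linarith
    · have h3 := hrs.2 w' hw'
      have h4 := hmin w' hw'
      simp only [d2] at h1 h3
      have hp : 0 < w.1 - w'.1 := by linarith
      have hq : 0 ≤ w'.2 - w.2 := by linarith
      have hb := mul_nonneg hq i3.le
      have k1 : (w.1 - w'.1) * (r - w.1) + 2 * ((w'.2 - w.2) * w.2) ≤ (w.1 - w'.1) * (w.1 - l) := by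
        nlinarith
      have k2 : 0 < (w.1 - w'.1) * (w.1 - l) := by nlinarith [mul_pos hp hp]
      have k3 := pos_of_mul_pos_right k2 hp.le
      refine ⟨le_of_mul_le_mul_left (by linarith) hp, by linarith, Or.inr fun h5 => ?_⟩
      have k4 := mul_le_mul_of_nonneg_left h5 hp.le
      have k5 : (w'.2 - w.2) * w.2 = 0 := by linarith
      have k6 : w'.2 = w.2 := by
        rcases mul_eq_zero.mp k5 with h | h <;> linarith
      have k7 : w'.1 = 2 * l - w.1 := by
        rw [k6] at h1
        have : (w.1 - w'.1) * (w'.1 - (2 * l - w.1)) = 0 := by nlinarith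
        rcases mul_eq_zero.mp this with h | h <;> linarith
      rw [← k7, ← k6]; exact hw'
  obtain ⟨a1, a2, a3⟩ := R2
  obtain ⟨b1, b2, b3⟩ := L2
  refine ⟨r - w.1, by linarith, rect_of S hw ?_ ?_, ?_, ?_⟩
  · convert hr' using 1; ext <;> simp
  · have : l = w.1 - (r - w.1) := by linarith
    rw [← this]; convert hl' using 1; ext <;> simp
  · rcases a3 with h | h
    · left; linarith
    · right; convert h b1 using 2; ring
  · rcases b3 with h | h
    · left; linarith
    · right; convert h a1 using 2; linarith

/-- full row data -/
structure RowD (W : Finset (ℝ × ℝ)) (ρ : ℝ) (w : ℝ × ℝ) (α : ℝ) : Prop where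
  mem : w ∈ W
  rect : Rect W ρ w α w.2
  right : w.1 + α = 1 ∨ (w.1 + 2 * α, w.2) ∈ W
  left : w.1 - α = 0 ∨ (w.1 - 2 * α, w.2) ∈ W

lemma RowD.bd {W : Finset (ℝ × ℝ)} {ρ : ℝ} {w α} (D : RowD W ρ w α) (S : Sit W ρ) (hα : 0 < α) :
    w.1 + α ≤ 1 ∧ 0 ≤ w.1 - α ∧ 2 * w.2 ≤ ρ := by
  have hw := (S.int w D.mem).2.2.1
  have h1 := D.rect (w.1 + α, 2 * w.2) (by simp [abs_of_pos hα])
    (by simp only; rw [abs_of_pos (by linarith)]; linarith)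
  have h2 := D.rect (w.1 - α, 2 * w.2) (by simp [abs_of_pos hα])
    (by simp only; rw [abs_of_pos (by linarith)]; linarith)
  exact ⟨h1.1.2.1, h2.1.1, h1.1.2.2.2⟩

lemma row_right {W : Finset (ℝ × ℝ)} {ρ : ℝ} (S : Sit W ρ) {w α} (hα : 0 < α) (D : RowD W ρ w α)
    (hmin : ∀ w' ∈ W, w.2 ≤ w'.2) (h : w.1 + α < 1) : RowD W ρ (w.1 + 2 * α, w.2) α := by
  have hk : (w.1 + 2 * α, w.2) ∈ W := D.right.resolve_left (by linarith)
  have hi := S.int w D.mem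
  obtain ⟨α', hα', h1, h2, h3⟩ := row S hk hmin
  have e1 : α' ≤ α := by
    have := (h1 (w.1 + 2 * α - α', w.2) (by simp [abs_of_pos hα']) (by simp [hi.2.2.1.le])).2 w D.mem
    simp only [d2] at this
    by_contra hc; push Not at hc
    nlinarith
  have e2 : α ≤ α' := by
    rcases h3 with h3 | h3
    · simp only at h3; linarith [hi.1]
    · have := (D.rect (w.1 + α, w.2) (by simp [abs_of_pos hα]) (by simp [hi.2.2.1.le])).2 _ h3
      simp only [d2] at this
      by_contra hc; push Not at hc
      nlinarith
  obtain rfl : α' = α := le_antisymm e1 e2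
  exact ⟨hk, h1, h2, h3⟩

lemma row_left {W : Finset (ℝ × ℝ)} {ρ : ℝ} (S : Sit W ρ) {w α} (hα : 0 < α) (D : RowD W ρ w α)
    (hmin : ∀ w' ∈ W, w.2 ≤ w'.2) (h : 0 < w.1 - α) : RowD W ρ (w.1 - 2 * α, w.2) α := by
  have hk : (w.1 - 2 * α, w.2) ∈ W := D.left.resolve_left (by linarith)
  have hi := S.int w D.mem
  obtain ⟨α', hα', h1, h2, h3⟩ := row S hk hmin
  have e1 : α' ≤ α := by
    have := (h1 (w.1 - 2 * α + α', w.2) (by simp [abs_of_pos hα']) (by simp [hi.2.2.1.le])).2 w D.mem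
    simp only [d2] at this
    by_contra hc; push Not at hc
    nlinarith
  have e2 : α ≤ α' := by
    rcases h2 with h2 | h2
    · simp only at h2; linarith [hi.2.1]
    · have := (D.rect (w.1 - α, w.2) (by simp [abs_of_pos hα]) (by simp [hi.2.2.1.le])).2 _ h2
      simp only [d2] at this
      by_contra hc; push Not at hc
      nlinarith
  obtain rfl : α' = α := le_antisymm e1 e2
  exact ⟨hk, h1, h2, h3⟩

lemma row_cover {W : Finset (ℝ × ℝ)} {ρ : ℝ} (S : Sit W ρ) {w0 α} (hα : 0 < α)
    (D0 : RowD W ρ w0 α) (hmin : ∀ w' ∈ W, w0.2 ≤ w'.2) {x : ℝ} (hx0 : 0 ≤ x) (hx1 : x ≤ 1) :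
    ∃ a, RowD W ρ (a, w0.2) α ∧ |x - a| ≤ α := by
  classical
  set T := W.filter fun w => w.2 = w0.2 ∧ RowD W ρ w α with hT
  have hTm : ∀ w, w ∈ T ↔ w.2 = w0.2 ∧ RowD W ρ w α := by
    intro w; simp only [hT, Finset.mem_filter]; exact ⟨fun h => h.2, fun h => ⟨h.2.mem, h⟩⟩
  obtain ⟨m, hm, hm'⟩ := T.exists_min_image Prod.fst ⟨w0, (hTm _).2 ⟨rfl, D0⟩⟩
  obtain ⟨m1, m2⟩ := (hTm m).1 hm
  have hm0 : m.1 - α ≤ 0 := by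
    by_contra hc; push Not at hc
    have := row_left S hα m2 (by rw [m1]; exact hmin) hc
    have := hm' (m.1 - 2 * α, m.2) ((hTm _).2 ⟨m1, this⟩)
    simp only at this; linarith
  obtain ⟨k, hk, hk'⟩ := (T.filter fun w => w.1 - α ≤ x).exists_max_image Prod.fst
    ⟨m, by simp only [Finset.mem_filter]; exact ⟨hm, hm0.trans hx0⟩⟩
  rw [Finset.mem_filter] at hk
  obtain ⟨k1, k2⟩ := (hTm k).1 hk.1
  refine ⟨k.1, by rw [← k1]; exact k2, abs_le.mpr ⟨by linarith [hk.2], ?_⟩⟩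
  by_contra hc; push Not at hc
  have := row_right S hα k2 (by rw [k1]; exact hmin) (by linarith)
  have := hk' (k.1 + 2 * α, k.2) (by
    rw [Finset.mem_filter]; exact ⟨(hTm _).2 ⟨k1, this⟩, by simp only; linarith⟩)
  simp only at this; linarith

lemma up_nb {W : Finset (ℝ × ℝ)} {ρ : ℝ} (S : Sit W ρ) {w α} (hα : 0 < α) (D : RowD W ρ w α)
    (h : 2 * w.2 < ρ) : (w.1, 3 * w.2) ∈ W ∧ Rect W ρ (w.1, 3 * w.2) α w.2 := by
  have hi := S.int w D.mem
  have hb := hi.2.2.1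
  have c0 := D.rect (w.1, 2 * w.2) (by simp [hα.le])
    (by simp only; rw [abs_of_pos (by linarith)]; linarith)
  have c1 := D.rect (w.1 + α, 2 * w.2) (by simp [abs_of_pos hα])
    (by simp only; rw [abs_of_pos (by linarith)]; linarith)
  have c2 := D.rect (w.1 - α, 2 * w.2) (by simp [abs_of_pos hα])
    (by simp only; rw [abs_of_pos (by linarith)]; linarith)
  obtain ⟨w', hw', h2, h3⟩ := tie c0 (0, 1) (by
      filter_upwards [Ioo_mem_nhdsGT (sub_pos.mpr h)] with ε hε
      have := hε.1; have := hε.2; have := hi.1; have := hi.2.1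
      simp only [Q, mem_ofPred_eq, Prod.fst_add, Prod.snd_add, Prod.smul_fst, Prod.smul_snd,
        smul_eq_mul]
      refine ⟨?_, ?_, ?_, ?_⟩ <;> linarith) (by
      intro ε hε hc
      have := S.sym w D.mem (0, w.2 + ε) (by convert hc using 1; ext <;> simp; ring)
      have := this.1.2.2.1
      simp at this; linarith)
  have e1 := c1.2 w' hw'
  have e2 := c2.2 w' hw'
  simp [dot] at h3
  simp only [d2] at h2 e1 e2
  have hx : w'.1 = w.1 := by
    apply le_antisymm
    · by_contra hc; push Not at hc; nlinarith
    · by_contra hc; push Not at hc; nlinarith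
  have hy : w'.2 = 3 * w.2 := by
    rw [hx] at h2
    have : (w'.2 - w.2) * (w'.2 - 3 * w.2) = 0 := by nlinarith
    rcases mul_eq_zero.mp this with h | h <;> linarith
  have hw'' : (w.1, 3 * w.2) ∈ W := by rw [← hx, ← hy]; exact hw'
  refine ⟨hw'', rect_of S hw'' ?_ ?_⟩
  · have e : ((w.1, 3 * w.2).1 + α, (w.1, 3 * w.2).2 - w.2) = (w.1 + α, 2 * w.2) := by
      ext <;> simp; ring
    rw [e]
    refine ⟨c1.1, fun k hk => le_trans (le_of_eq ?_) (c1.2 k hk)⟩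
    simp only [d2]; ring
  · have e : ((w.1, 3 * w.2).1 - α, (w.1, 3 * w.2).2 - w.2) = (w.1 - α, 2 * w.2) := by
      ext <;> simp; ring
    rw [e]
    refine ⟨c2.1, fun k hk => le_trans (le_of_eq ?_) (c2.2 k hk)⟩
    simp only [d2]; ring

/-- upper bound of the cell -/
lemma cell_sub {W : Finset (ℝ × ℝ)} {ρ : ℝ} (S : Sit W ρ) {w α} (hα : 0 < α) (D : RowD W ρ w α) :
    C W ρ w ⊆ Icc (w.1 - α) (w.1 + α) ×ˢ Icc 0 (2 * w.2) := by
  intro q hq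
  have hs := S.sym w D.mem (q - w) (by simpa using hq)
  have hR : ∀ p ∈ C W ρ w, p.1 ≤ w.1 + α := by
    intro p hp
    rcases D.right with h | h
    · rw [h]; exact hp.1.2.1
    · have := hp.2 _ h
      simp only [d2] at this
      by_contra hc; push Not at hc; nlinarith
  have h1 := hR q hq
  have h2 := hR _ hs
  have h3 := hs.1.2.2.1
  have h4 := hq.1.2.2.1
  simp at h2 h3
  exact ⟨⟨by linarith, h1⟩, ⟨h4, by linarith⟩⟩

end VG

namespace VG
open Filter Topology

lemma pert {W : Finset (ℝ × ℝ)} {ρ : ℝ} (hρ : 0 < ρ) (hnw : ¬ Win W ρ) (hWQ : ↑W ⊆ Q ρ)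
    {s : ℝ × ℝ} (hs : s ∈ W) {p : ℝ × ℝ} (hp : p ∈ Q ρ) {V : Set (ℝ × ℝ)} (hVm : MeasurableSet V)
    (u : ℝ × ℝ → ℝ × ℝ) (hu : ∀ j, u j ≠ 0)
    (hV : ∀ q ∈ V, ∃ k ∈ W, q ∈ C W ρ k ∧ d2 q p < d2 q k ∧ (k ≠ s → dot (q - k) (u k) ≤ 0)) :
    volume.real V ≤ volume.real (O W ρ s) / 2 := by
  refine key hρ hnw hs (fun _ => p) hVm ?_ (Eventually.of_forall fun _ => hp) ?_ u ?_ ?_ ?_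
  · intro q hq
    obtain ⟨k, _, hC, _⟩ := hV q hq
    exact hC.1
  · intro q hq
    obtain ⟨k, hk, hC, h, _⟩ := hV q hq
    exact Eventually.of_forall fun _ w hw => h.trans_le (hC.2 w hw)
  · intro j hj _
    exact feas_int (interior hρ hnw hWQ hj) _
  · intro j hj _
    have h1 := hf_add W ρ j (hu j)
    have h2 := half_le hρ hnw hWQ hj (feas_int (interior hρ hnw hWQ hj) (-u j))
    linarith
  · intro j hj hne
    rw [Set.disjoint_left]
    intro q hq hH
    obtain ⟨k, hk, hC, _, h⟩ := hV q hq
    have e := O_disj hk hH.1 hC hj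
    subst e
    exact absurd hH.2 (not_lt.mpr (h hne))

lemma vol_O_le {W : Finset (ℝ × ℝ)} {ρ : ℝ} (S : Sit W ρ) {w α} (hα : 0 < α) (D : RowD W ρ w α) :
    volume.real (O W ρ w) ≤ 4 * α * w.2 := by
  have hb := (S.int w D.mem).2.2.1
  have h1 : volume.real (O W ρ w) ≤ volume.real (Icc (w.1 - α) (w.1 + α) ×ˢ Icc 0 (2 * w.2)) :=
    measureReal_mono ((O_sub_C _ _ _).trans (cell_sub S hα D))
      (isCompact_Icc.prod isCompact_Icc).measure_lt_top.ne
  rw [Measure.volume_eq_prod, measureReal_prod_prod] at h1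
  refine h1.trans (le_of_eq ?_)
  rw [Real.volume_real_Icc_of_le (by linarith), Real.volume_real_Icc_of_le (by linarith)]
  ring

/-- trapezoid over an interval in the first coordinate -/
def trX (x0 h l m1 r m2 : ℝ) : Set (ℝ × ℝ) :=
  regionBetween (fun x => l - m1 * (x - x0)) (fun x => r + m2 * (x - x0)) (Ioo x0 (x0 + h))

lemma trX_meas (x0 h l m1 r m2 : ℝ) : MeasurableSet (trX x0 h l m1 r m2) :=
  measurableSet_regionBetween (by fun_prop) (by fun_prop) measurableSet_Ioo

lemma trX_vol {x0 h l m1 r m2 : ℝ} (hh : 0 ≤ h) (hlr : l ≤ r) (h1 : 0 ≤ m1) (h2 : 0 ≤ m2) :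
    volume.real (trX x0 h l m1 r m2) = (r - l) * h + (m1 + m2) * h ^ 2 / 2 := by
  have e : volume (trX x0 h l m1 r m2) =
      ENNReal.ofReal ((r - l) * h + (m1 + m2) * h ^ 2 / 2) := by
    rw [trX, Measure.volume_eq_prod, volume_regionBetween_eq_integral]
    · congr 1
      rw [← integral_Ioc_eq_integral_Ioo, ← intervalIntegral.integral_of_le (by linarith),
        intervalIntegral.integral_eq_sub_of_hasDerivAt
          (f := fun x => (r - l) * x + (m1 + m2) * (x - x0) ^ 2 / 2)]
      · ring
      · intro x _
        have := (((hasDerivAt_id x).const_mul (r - l))).add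
          (((((hasDerivAt_id x).sub_const x0).pow 2).const_mul (m1 + m2)).div_const 2)
        refine HasDerivAt.congr_deriv (f := fun x => (r - l) * x + (m1 + m2) * (x - x0) ^ 2 / 2)
          this ?_
        simp only [Pi.sub_apply, id]; norm_num; ring
      · apply Continuous.intervalIntegrable
        simp only [Pi.sub_def]; fun_prop
    · exact (Continuous.integrableOn_Icc (by fun_prop)).mono_set Ioo_subset_Icc_self
    · exact (Continuous.integrableOn_Icc (by fun_prop)).mono_set Ioo_subset_Icc_self
    · exact measurableSet_Ioo
    · intro x hx
      have h3 := mul_nonneg h1 (sub_nonneg.mpr hx.1.le)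
      have h4 := mul_nonneg h2 (sub_nonneg.mpr hx.1.le)
      linarith
  rw [Measure.real, e, ENNReal.toReal_ofReal]
  have := mul_nonneg (sub_nonneg.mpr hlr) hh
  positivity

def trY (x0 h l m1 r m2 : ℝ) : Set (ℝ × ℝ) := Prod.swap ⁻¹' (trX x0 h l m1 r m2)
lemma trY_meas (x0 h l m1 r m2 : ℝ) : MeasurableSet (trY x0 h l m1 r m2) :=
  measurable_swap (trX_meas _ _ _ _ _ _)
lemma trY_vol {x0 h l m1 r m2 : ℝ} (hh : 0 ≤ h) (hlr : l ≤ r) (h1 : 0 ≤ m1) (h2 : 0 ≤ m2) :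
    volume.real (trY x0 h l m1 r m2) = (r - l) * h + (m1 + m2) * h ^ 2 / 2 := by
  rw [← trX_vol (x0 := x0) hh hlr h1 h2, trY, Measure.real, Measure.real]
  congr 1
  exact (Measure.measurePreserving_swap (μ := (volume : Measure ℝ)) (ν := (volume : Measure ℝ))).measure_preimage
    (trX_meas _ _ _ _ _ _).nullMeasurableSet
lemma mem_trX {x0 h l m1 r m2 : ℝ} {q : ℝ × ℝ} : q ∈ trX x0 h l m1 r m2 ↔
    (x0 < q.1 ∧ q.1 < x0 + h) ∧ l - m1 * (q.1 - x0) < q.2 ∧ q.2 < r + m2 * (q.1 - x0) := by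
  simp [trX, regionBetween]
lemma mem_trY {x0 h l m1 r m2 : ℝ} {q : ℝ × ℝ} : q ∈ trY x0 h l m1 r m2 ↔
    (x0 < q.2 ∧ q.2 < x0 + h) ∧ l - m1 * (q.2 - x0) < q.1 ∧ q.1 < r + m2 * (q.2 - x0) := by
  simp [trY, mem_trX]
lemma exists_t {b c : ℝ} (hb : 0 < b) (hc : 0 < c) (K : ℝ) (hK : K < b ^ 2) :
    ∃ t : ℝ, 0 < t ∧ t < b ∧ t < c ∧ K < (b - t / 2) ^ 2 := by
  have h1 : ∀ᶠ t in 𝓝[>] (0:ℝ), K < (b - t / 2) ^ 2 := by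
    have hc : Continuous fun t : ℝ => (b - t / 2) ^ 2 := by fun_prop
    exact (hc.continuousAt.eventually_const_lt (by simpa using hK)).filter_mono nhdsWithin_le_nhds
  have h2 : ∀ᶠ t in 𝓝[>] (0:ℝ), t ∈ Ioo 0 b := Ioo_mem_nhdsGT hb
  have h3 : ∀ᶠ t in 𝓝[>] (0:ℝ), t ∈ Ioo 0 c := Ioo_mem_nhdsGT hc
  obtain ⟨t, h1, h2, h3⟩ := (h1.and (h2.and h3)).exists
  exact ⟨t, h2.1, h2.2, h3.2, h1⟩

lemma case1 {W : Finset (ℝ × ℝ)} {ρ : ℝ} (S : Sit W ρ) (hnw : ¬ Win W ρ) (hWQ : ↑W ⊆ Q ρ)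
    {a b α : ℝ} (hα : 0 < α) (D : RowD W ρ (a, b) α) (h2b : 2 * b = ρ)
    (DL : RowD W ρ (a - 2 * α, b) α) (DR : RowD W ρ (a + 2 * α, b) α)
    (hb : 2 * α ^ 2 < b ^ 2) : False := by
  obtain ⟨i1, i2, i3, i4⟩ := S.int _ D.mem
  simp only at i1 i2 i3 i4
  obtain ⟨t, t0, t1, t2, t3⟩ := exists_t i3 (c := 2 * α ^ 2 / b) (by positivity) _ hb
  rw [lt_div_iff₀ i3] at t2
  obtain ⟨m, hm⟩ : ∃ m, m * (2 * α) = t := ⟨t / (2 * α), by field_simp⟩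
  have hm0 : 0 < m := by
    by_contra hc; push Not at hc; nlinarith
  have hne : (a + 2 * α, b) ≠ (a - 2 * α, b) := by
    intro h; have := congrArg Prod.fst h; simp only at this; linarith
  have hv := pert S.hρ hnw hWQ D.mem (p := (a, b + t))
    ⟨i1.le, i2.le, by simp only; linarith, by simp only; linarith⟩
    (trY_meas (b + t / 2) (b - t / 2) (a - α) m (a + α) m)
    (fun j => if j = (a - 2 * α, b) then (-1, 0) else (1, 0))
    (by intro j; split_ifs <;> simp) (by
      rintro ⟨x, y⟩ hq
      rw [mem_trY] at hq
      obtain ⟨⟨y1, y2⟩, x1, x2⟩ := hq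
      simp only at y1 y2 x1 x2
      have hms : m * (y - (b + t / 2)) ≤ α := by
        have : m * (y - (b + t / 2)) ≤ m * b := mul_le_mul_of_nonneg_left (by linarith) hm0.le
        have : m * b ≤ α := by
          by_contra hc; push Not at hc; nlinarith
        linarith
      have hy : |y - b| ≤ b := abs_le.mpr ⟨by linarith, by linarith⟩
      have hmt : m * (y - (b + t / 2)) * (2 * α) = t * (y - (b + t / 2)) := by rw [← hm]; ring
      rcases le_total x (a - α) with hx | hx
      · refine ⟨_, DL.mem, DL.rect _ (abs_le.mpr ⟨?_, ?_⟩) hy, ?_, fun _ => ?_⟩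
        · simp only; linarith
        · simp only; linarith
        · simp only [d2]; nlinarith
        · simp [dot]; linarith
      rcases le_total x (a + α) with hx' | hx'
      · refine ⟨_, D.mem, D.rect _ (abs_le.mpr ⟨?_, ?_⟩) hy, ?_, fun h => absurd rfl h⟩
        · simp only; linarith
        · simp only; linarith
        · simp only [d2]; nlinarith
      · refine ⟨_, DR.mem, DR.rect _ (abs_le.mpr ⟨?_, ?_⟩) hy, ?_, fun _ => ?_⟩
        · simp only; linarith
        · simp only; linarith
        · simp only [d2]; nlinarith
        · rw [if_neg hne]; simp [dot]; linarith)
  rw [trY_vol (by linarith) (by linarith) hm0.le hm0.le] at hv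
  have h4 := vol_O_le S hα D
  simp only at h4
  nlinarith [mul_pos hm0 (sub_pos.mpr t3)]

lemma case2 {W : Finset (ℝ × ℝ)} {ρ : ℝ} (S : Sit W ρ) (hnw : ¬ Win W ρ) (hWQ : ↑W ⊆ Q ρ)
    {a b α : ℝ} (hα : 0 < α) (D : RowD W ρ (a, b) α) (h2b : 2 * b < ρ)
    (DR : RowD W ρ (a + 2 * α, b) α)  : False := by
  obtain ⟨i1, i2, i3, i4⟩ := S.int _ D.mem
  simp only at i1 i2 i3 i4
  obtain ⟨U, RU⟩ := up_nb S hα D h2b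
  obtain ⟨t, t0, t1, t2, t3⟩ := exists_t i3 (c := 2 * α ^ 2 / b) (by positivity) 0 (by positivity)
  rw [lt_div_iff₀ i3] at t2
  obtain ⟨m, hm⟩ : ∃ m, m * (2 * α) = t := ⟨t / (2 * α), by field_simp⟩
  have hm0 : 0 < m := by
    by_contra hc; push Not at hc; nlinarith
  have hne : (a + 2 * α, b) ≠ (a, 3 * b) := by
    intro h; have := congrArg Prod.fst h; simp only at this; linarith
  have hv := pert S.hρ hnw hWQ D.mem (p := (a, b + t))
    ⟨i1.le, i2.le, by simp only; linarith, by simp only; linarith⟩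
    ((trY_meas (b + t / 2) (b - t / 2) (a - α) 0 (a + α) m).union
      (trY_meas (2 * b) (t / 2) (a - α) 0 (a + α) 0))
    (fun j => if j = (a, 3 * b) then (0, 1) else (1, 0))
    (by intro j; split_ifs <;> simp) (by
      rintro ⟨x, y⟩ (hq | hq)
      · rw [mem_trY] at hq
        obtain ⟨⟨y1, y2⟩, x1, x2⟩ := hq
        simp only at y1 y2 x1 x2
        have hms : m * (y - (b + t / 2)) ≤ α := by
          have : m * (y - (b + t / 2)) ≤ m * b := mul_le_mul_of_nonneg_left (by linarith) hm0.le
          have : m * b ≤ α := by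
            by_contra hc; push Not at hc; nlinarith
          linarith
        have hy : |y - b| ≤ b := abs_le.mpr ⟨by linarith, by linarith⟩
        have hmt : m * (y - (b + t / 2)) * (2 * α) = t * (y - (b + t / 2)) := by rw [← hm]; ring
        rcases le_total x (a + α) with hx' | hx'
        · refine ⟨_, D.mem, D.rect _ (abs_le.mpr ⟨?_, ?_⟩) hy, ?_, fun h => absurd rfl h⟩
          · simp only; linarith
          · simp only; linarith
          · simp only [d2]; nlinarith
        · refine ⟨_, DR.mem, DR.rect _ (abs_le.mpr ⟨?_, ?_⟩) hy, ?_, fun _ => ?_⟩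
          · simp only; linarith
          · simp only; linarith
          · simp only [d2]; nlinarith
          · rw [if_neg hne]; simp [dot]; linarith
      · rw [mem_trY] at hq
        obtain ⟨⟨y1, y2⟩, x1, x2⟩ := hq
        simp only at y1 y2 x1 x2
        refine ⟨_, U, RU _ (abs_le.mpr ⟨?_, ?_⟩) (abs_le.mpr ⟨?_, ?_⟩), ?_, fun _ => ?_⟩
        · simp only; linarith
        · simp only; linarith
        · simp only; linarith
        · simp only; linarith
        · simp only [d2]; nlinarith
        · simp [dot]; linarith)
  have hd : Disjoint (trY (b + t / 2) (b - t / 2) (a - α) 0 (a + α) m)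
      (trY (2 * b) (t / 2) (a - α) 0 (a + α) 0) := by
    rw [Set.disjoint_left]
    intro q h1 h2
    rw [mem_trY] at h1 h2
    linarith [h1.1.2, h2.1.1]
  have hfin : ∀ {x0 h l m1 r m2 : ℝ}, 0 < volume.real (trY x0 h l m1 r m2) →
      volume (trY x0 h l m1 r m2) ≠ ⊤ := by
    intro x0 h l m1 r m2 h0 he
    simp [Measure.real, he] at h0
  have v1 := trY_vol (x0 := b + t / 2) (h := b - t / 2) (l := a - α) (m1 := 0) (r := a + α)
    (m2 := m) (by linarith) (by linarith) le_rfl hm0.le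
  have v2 := trY_vol (x0 := 2 * b) (h := t / 2) (l := a - α) (m1 := 0) (r := a + α)
    (m2 := 0) (by linarith) (by linarith) le_rfl le_rfl
  have p1 : 0 < m * (b - t / 2) ^ 2 := mul_pos hm0 t3
  rw [measureReal_union hd (trY_meas _ _ _ _ _ _)
    (hfin (by rw [v1]; nlinarith [mul_pos hα (show 0 < b - t / 2 by linarith)]))
    (hfin (by rw [v2]; nlinarith [mul_pos hα t0])), v1, v2] at hv
  have h4 := vol_O_le S hα D
  simp only at h4
  nlinarith

lemma case3 {W : Finset (ℝ × ℝ)} {ρ : ℝ} (S : Sit W ρ) (hnw : ¬ Win W ρ) (hWQ : ↑W ⊆ Q ρ)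
    {b : ℝ} (D : RowD W ρ (1/2, b) (1/2)) (h2b : 2 * b < ρ) (hb : b < 1 / 4) : False := by
  obtain ⟨i1, i2, i3, i4⟩ := S.int _ D.mem
  simp only at i1 i2 i3 i4
  obtain ⟨U, RU⟩ := up_nb S one_half_pos D h2b
  simp only at U RU
  obtain ⟨t, t0, t1, t2, t3⟩ := exists_t (b := 1/2) (by norm_num) (c := 4 * b ^ 2) (by positivity)
    (4 * b ^ 2) (by nlinarith)
  obtain ⟨m, hm⟩ : ∃ m, m * (2 * b) = t := ⟨t / (2 * b), by field_simp⟩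
  have hm0 : 0 < m := by
    by_contra hc; push Not at hc; nlinarith
  have hv := pert S.hρ hnw hWQ D.mem (p := (1/2 + t, b))
    ⟨by simp only; linarith, by simp only; linarith, i3.le, i4.le⟩
    (trX_meas (1/2 + t / 2) (1/2 - t / 2) 0 0 (2 * b) m)
    (fun j => (0, 1))
    (by intro j; simp) (by
      rintro ⟨x, y⟩ hq
      rw [mem_trX] at hq
      obtain ⟨⟨y1, y2⟩, x1, x2⟩ := hq
      simp only at y1 y2 x1 x2
      have hms : m * (x - (1/2 + t / 2)) ≤ b := by
        have : m * (x - (1/2 + t / 2)) ≤ m * (1/2) :=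
          mul_le_mul_of_nonneg_left (by linarith) hm0.le
        have : m * (1/2) ≤ b := by
          by_contra hc; push Not at hc; nlinarith
        linarith
      have hy : |x - 1/2| ≤ 1/2 := abs_le.mpr ⟨by linarith, by linarith⟩
      have hmt : m * (x - (1/2 + t / 2)) * (2 * b) = t * (x - (1/2 + t / 2)) := by rw [← hm]; ring
      rcases le_total y (2 * b) with hx' | hx'
      · refine ⟨_, D.mem, D.rect _ hy (abs_le.mpr ⟨?_, ?_⟩), ?_, fun h => absurd rfl h⟩
        · simp only; linarith
        · simp only; linarith
        · simp only [d2]; nlinarith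
      · refine ⟨_, U, RU _ hy (abs_le.mpr ⟨?_, ?_⟩), ?_, fun _ => ?_⟩
        · simp only; linarith
        · simp only; linarith
        · simp only [d2]; nlinarith
        · simp [dot]; linarith)
  rw [trX_vol (by linarith) (by linarith) le_rfl hm0.le] at hv
  have h4 := vol_O_le S one_half_pos D
  simp only at h4
  nlinarith [mul_pos hm0 (sub_pos.mpr t3)]

end VG

namespace VG
open Filter Topology

lemma sep {W : Finset (ℝ × ℝ)} {ρ b α : ℝ} (hα : 0 < α)
    (hall : ∀ k ∈ W, RowD W ρ (k.1, b) α ∧ k.2 = b) (hb : 0 < b) (S : Sit W ρ) {k k' : ℝ × ℝ} (hk : k ∈ W) (hk' : k' ∈ W)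
    (hlt : k.1 < k'.1) : k.1 + 2 * α ≤ k'.1 := by
  obtain ⟨D, e⟩ := hall k hk
  obtain ⟨D', e'⟩ := hall k' hk'
  have ek' : k' = (k'.1, b) := by ext <;> simp [e']
  have h1 : k.1 + α < k'.1 := by
    by_contra hc; push Not at hc
    have : k' ∈ C W ρ (k.1, b) := D.rect _ (abs_le.mpr ⟨by simp only; linarith, by simp only; linarith⟩) (by simp [e', hb.le])
    have := congrArg Prod.fst (self_excl hk' this)
    simp only at this; linarith
  rcases D.right with h | h
  · have := (S.int _ hk').2.1
    simp only at h; linarith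
  · by_contra hc; push Not at hc
    obtain ⟨D2, -⟩ := hall _ h
    simp only at D2
    have : k' ∈ C W ρ (k.1 + 2 * α, b) := D2.rect _ (abs_le.mpr ⟨by simp only; linarith, by simp only; linarith⟩) (by simp [e', hb.le])
    have := congrArg Prod.fst (self_excl hk' this)
    simp only at this; linarith

lemma width {W : Finset (ℝ × ℝ)} {ρ b α : ℝ} (hα : 0 < α)
    (hall : ∀ k ∈ W, RowD W ρ (k.1, b) α ∧ k.2 = b) (hb : 0 < b) (S : Sit W ρ) :
    W.card * (2 * α) ≤ 1 := by
  have hd : (↑W : Set (ℝ × ℝ)).PairwiseDisjoint (fun k : ℝ × ℝ => Ioo (k.1 - α) (k.1 + α)) := by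
    intro k hk k' hk' hne
    rw [Function.onFun, Set.disjoint_left]
    intro x hx hx'
    have hx1 : k.1 ≠ k'.1 := fun h => hne (Prod.ext h ((hall k hk).2.trans (hall k' hk').2.symm))
    rcases lt_or_gt_of_ne hx1 with h | h
    · have := sep hα hall hb S hk hk' h
      linarith [hx.2, hx'.1]
    · have := sep hα hall hb S hk' hk h
      linarith [hx'.2, hx.1]
  have h1 := measureReal_biUnion_finset (μ := (volume : Measure ℝ)) hd (fun _ _ => measurableSet_Ioo)
    (fun _ _ => by simp)
  have h2 : volume.real (⋃ k ∈ W, Ioo (k.1 - α) (k.1 + α)) ≤ volume.real (Icc (0:ℝ) 1) := by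
    refine measureReal_mono ?_ (by simp)
    simp only [iUnion_subset_iff]
    intro k hk x hx
    have := (hall k hk).1.bd S hα
    simp only at this
    exact ⟨by linarith [hx.1], by linarith [hx.2]⟩
  rw [h1, Real.volume_real_Icc_of_le zero_le_one] at h2
  have h3 : ∀ k ∈ W, volume.real (Ioo (k.1 - α) (k.1 + α)) = 2 * α := by
    intro k _
    rw [Real.volume_real_Ioo_of_le (by linarith)]; ring
  rw [Finset.sum_congr rfl h3] at h2
  simpa using h2

theorem main (W : Finset (ℝ × ℝ)) {ρ : ℝ} (hn : 3 ≤ W.card) (h1 : Real.sqrt 2 / W.card < ρ)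
    (h2 : ρ ≤ 1) (hWQ : ↑W ⊆ Q ρ) : Win W ρ := by
  by_contra hnw
  have hn3 : (3:ℝ) ≤ W.card := by exact_mod_cast hn
  have hρ : 0 < ρ := lt_of_le_of_lt (by positivity) h1
  have hne : W.Nonempty := Finset.card_pos.mp (by omega)
  have S : Sit W ρ := ⟨hρ, fun w hw => interior hρ hnw hWQ hw, fun s hs v hv =>
    C_sym hρ hnw hWQ hs hv⟩
  obtain ⟨w, hw, hmin⟩ := W.exists_min_image (fun w => w.2) hne
  obtain ⟨α, hα, r1, r2, r3⟩ := row S hw hmin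
  have D0 : RowD W ρ w α := ⟨hw, r1, r2, r3⟩
  obtain ⟨i1, i2, i3, i4⟩ := S.int w hw
  set b := w.2 with hbdef
  have hcov : ∀ x, 0 ≤ x → x ≤ 1 → ∃ a, RowD W ρ (a, b) α ∧ |x - a| ≤ α := fun x hx0 hx1 =>
    row_cover S hα D0 hmin hx0 hx1
  have hb := (D0.bd S hα).2.2
  rcases hb.eq_or_lt with hb | hb
  · have hall : ∀ k ∈ W, RowD W ρ (k.1, b) α ∧ k.2 = b := by
      intro k hk
      obtain ⟨j1, j2, j3, j4⟩ := S.int k hk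
      obtain ⟨a, Da, ha⟩ := hcov k.1 j1.le j2.le
      have := self_excl hk (Da.rect k ha (abs_le.mpr ⟨by simp only; linarith, by simp only; linarith⟩))
      rw [this]; exact ⟨Da, rfl⟩
    have hwid := width hα hall i3 S
    obtain ⟨a, Da, ha⟩ := hcov (1/2) (by norm_num) (by norm_num)
    obtain ⟨ha1, ha2⟩ := abs_le.mp ha
    have h6 : α ≤ 1 / 6 := by nlinarith
    refine case1 S hnw hWQ hα Da hb (row_left S hα Da hmin (by simp only; linarith))
      (row_right S hα Da hmin (by simp only; linarith)) ?_
    rw [div_lt_iff₀ (by linarith)] at h1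
    have h7 : Real.sqrt 2 * (2 * α) < 2 * b := by
      have hs : 0 < Real.sqrt 2 := by positivity
      have : Real.sqrt 2 * (2 * α) < ρ * W.card * (2 * α) := mul_lt_mul_of_pos_right h1 (by linarith)
      nlinarith
    have h8 : Real.sqrt 2 * α < b := by linarith
    have h9 := pow_lt_pow_left₀ h8 (by positivity) two_ne_zero
    rwa [mul_pow, Real.sq_sqrt (by norm_num)] at h9
  · obtain ⟨a, Da, ha⟩ := hcov 0 le_rfl zero_le_one
    obtain ⟨ha1, ha2⟩ := abs_le.mp ha
    have hbd := Da.bd S hα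
    simp only at hbd
    have haα : a = α := by linarith [hbd.2.1]
    rcases hbd.1.lt_or_eq with h | h
    · exact case2 S hnw hWQ hα Da hb (row_right S hα Da hmin h)
    · have e : α = 1 / 2 := by linarith
      rw [haα, e] at Da
      obtain ⟨U, RU⟩ := up_nb S one_half_pos Da hb
      simp only at U RU
      have h4b : 4 * b ≤ ρ := by
        have := (RU (1/2, 4 * b) (by simp) (abs_le.mpr ⟨by simp only; linarith, by simp only; linarith⟩)).1.2.2.2
        simpa using this
      by_cases hq : b < 1 / 4
      · exact case3 S hnw hWQ Da hb hq
      · have hb4 : b = 1 / 4 := by linarith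
        have hρ1 : ρ = 1 := by linarith
        have hsub : W ⊆ {(1/2, b), (1/2, 3 * b)} := by
          intro k hk
          obtain ⟨j1, j2, j3, j4⟩ := S.int k hk
          have hx : |k.1 - 1/2| ≤ 1/2 := abs_le.mpr ⟨by linarith, by linarith⟩
          rw [Finset.mem_insert, Finset.mem_singleton]
          rcases le_total k.2 (1/2) with h | h
          · left
            exact self_excl hk (Da.rect k hx (abs_le.mpr ⟨by simp only; linarith, by simp only; linarith⟩))
          · right
            exact self_excl hk (RU k hx (abs_le.mpr ⟨by simp only; linarith, by simp only; linarith⟩))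
        have := (Finset.card_le_card hsub).trans Finset.card_le_two
        omega
end VG

namespace VG
open Filter Topology

def pr (q : EuclideanSpace ℝ (Fin 2)) : ℝ × ℝ := (q 0, q 1)
noncomputable def ie (p : ℝ × ℝ) : EuclideanSpace ℝ (Fin 2) := !₂[p.1, p.2]
lemma pr_ie (p : ℝ × ℝ) : pr (ie p) = p := by simp [pr, ie]
lemma ie_pr (q : EuclideanSpace ℝ (Fin 2)) : ie (pr q) = q := by
  ext i; fin_cases i <;> simp [pr, ie]
lemma pr_inj : Function.Injective pr := Function.LeftInverse.injective ie_pr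
lemma ie_inj : Function.Injective ie := Function.LeftInverse.injective pr_ie
lemma dist_pr (p q : EuclideanSpace ℝ (Fin 2)) : dist p q = Real.sqrt (d2 (pr p) (pr q)) := by
  rw [EuclideanSpace.dist_eq, Fin.sum_univ_two]
  simp [d2, pr, Real.dist_eq]
lemma vol_pr (A : Set (ℝ × ℝ)) : volume (pr ⁻¹' A) = volume A := by
  have h := (EuclideanSpace.volume_preserving_symm_measurableEquiv_toLp (Fin 2)).trans
    (volume_preserving_finTwoArrow ℝ)
  exact h.measure_preimage_equiv A

end VG

theorem stmt_0 (n : ℕ) (hn : 3 ≤ n) (ρ : ℝ) (hρ1 : Real.sqrt 2 / n < ρ) (hρ2 : ρ ≤ 1)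
    (W : Set (EuclideanSpace ℝ (Fin 2))) (hWQ : W ⊆ board ρ) (hWfin : W.Finite)
    (hWcard : W.ncard = n) :
    ∃ B : Set (EuclideanSpace ℝ (Fin 2)), B ⊆ board ρ ∧ B.Finite ∧ B.ncard = n ∧
      volume {q | q ∈ board ρ ∧ infDist q B < infDist q W} > ENNReal.ofReal (ρ / 2) := by
  classical
  set W' : Finset (ℝ × ℝ) := hWfin.toFinset.image VG.pr with hW'
  have hc : W'.card = n := by
    rw [hW', Finset.card_image_of_injective _ VG.pr_inj, ← Set.ncard_eq_toFinset_card W hWfin,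
      hWcard]
  have hQ : (↑W' : Set (ℝ × ℝ)) ⊆ VG.Q ρ := by
    intro q hq
    simp only [hW', Finset.coe_image, Set.Finite.coe_toFinset] at hq
    obtain ⟨w, hw, rfl⟩ := hq
    obtain ⟨⟨h1, h2⟩, h3, h4⟩ := hWQ hw
    exact ⟨h1, h2, h3, h4⟩
  obtain ⟨B, hB1, hB2, hB3⟩ := VG.main W' (hc ▸ hn) (by rw [hc]; exact hρ1) hρ2 hQ
  have hWne : W.Nonempty := by
    rw [← Set.ncard_pos hWfin]; omega
  refine ⟨VG.ie '' B, ?_, B.finite_toSet.image _, ?_, ?_⟩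
  · rintro _ ⟨b, hb, rfl⟩
    obtain ⟨h1, h2, h3, h4⟩ := hB1 hb
    exact ⟨⟨by simpa [VG.ie] using h1, by simpa [VG.ie] using h2⟩,
      by simpa [VG.ie] using h3, by simpa [VG.ie] using h4⟩
  · rw [Set.ncard_image_of_injective _ VG.ie_inj, Set.ncard_coe_finset, hB2, hc]
  · rw [gt_iff_lt]
    set A := {q | q ∈ VG.Q ρ ∧ ∃ b ∈ B, ∀ w ∈ W', VG.d2 q b < VG.d2 q w} with hA
    have hρ0 : 0 < ρ := lt_of_le_of_lt (by positivity) hρ1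
    have h1 : ENNReal.ofReal (ρ / 2) < volume A :=
      (ENNReal.ofReal_lt_iff_lt_toReal (by linarith)
        (VG.fin_sub fun q hq => hq.1)).mpr hB3
    rw [← VG.vol_pr] at h1
    refine h1.trans_le (measure_mono ?_)
    rintro q ⟨⟨h1, h2, h3, h4⟩, b, hb, h⟩
    refine ⟨⟨⟨h1, h2⟩, h3, h4⟩, ?_⟩
    obtain ⟨w, hw, he⟩ := hWfin.isCompact.exists_infDist_eq_dist hWne q
    rw [he]
    refine (infDist_le_dist_of_mem (Set.mem_image_of_mem VG.ie hb)).trans_lt ?_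
    rw [VG.dist_pr, VG.dist_pr, VG.pr_ie]
    refine Real.sqrt_lt_sqrt (by unfold VG.d2; positivity) (h _ ?_)
    rw [hW']
    exact Finset.mem_image_of_mem _ (by simpa using hw)
end

section
/- Let n ≥ 3 be a natural number and let ρ be a real number with 0 < ρ ≤ √2/n, and set W = {((2i−1)/(2n), ρ/2) : i = 1, …, n} ⊆ Q (the 1×n grid placement). Then for every finite set B ⊆ Q with |B| = n one has μ({q ∈ Q : infDist(q, B) < infDist(q, W)}) < ρ/2. (Wilma wins for n ≥ 3 and ρ ≤ √2/n by playing the 1×n grid.) -/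
open MeasureTheory Metric Set
open scoped ENNReal

theorem trap (S : Set (ℝ × ℝ)) (y0 y1 α β γ δ : ℝ) (h01 : y0 ≤ y1)
    (hw0 : α * y0 + β ≤ γ * y0 + δ) (hw1 : α * y1 + β ≤ γ * y1 + δ)
    (hS : ∀ p ∈ S, y0 ≤ p.1 ∧ p.1 ≤ y1 ∧ α * p.1 + β < p.2 ∧ p.2 < γ * p.1 + δ) :
    volume S ≤ ENNReal.ofReal
      ((y1 - y0) * ((γ * y0 + δ - (α * y0 + β)) + (γ * y1 + δ - (α * y1 + β))) / 2) := by
  have hsub : S ⊆ regionBetween (fun y => α * y + β) (fun y => γ * y + δ) (Icc y0 y1) := by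
    intro p hp
    obtain ⟨h1, h2, h3, h4⟩ := hS p hp
    exact ⟨⟨h1, h2⟩, h3, h4⟩
  refine (measure_mono hsub).trans ?_
  rw [Measure.volume_eq_prod, volume_regionBetween_eq_integral]
  · apply le_of_eq
    congr 1
    rw [integral_Icc_eq_integral_Ioc, ← intervalIntegral.integral_of_le h01]
    have : ∀ y, ((fun y => γ * y + δ) - fun y => α * y + β) y = (γ - α) * y + (δ - β) := by
      intro y; simp; ring
    simp_rw [this]
    rw [intervalIntegral.integral_add (by apply Continuous.intervalIntegrable; fun_prop) (by simp),
      intervalIntegral.integral_const_mul, integral_id]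
    simp
    ring
  · exact (Continuous.integrableOn_Icc (by fun_prop))
  · exact (Continuous.integrableOn_Icc (by fun_prop))
  · exact measurableSet_Icc
  · intro y hy
    rcases hy with ⟨ha, hb⟩
    show α * y + β ≤ γ * y + δ
    rcases le_total (γ - α) 0 with h | h <;> nlinarith

theorem ineqU1 (r s t : ℝ) (hr2 : r ^ 2 ≤ 2) (hs0 : 0 < s) (hs : s ≤ 1/2) (ht0 : 0 < t)
    (ht : t ≤ r / 2) (hT : s * (1 - s) ≤ r * t + t ^ 2) (hU : r * t - t ^ 2 ≤ s ^ 2 + s) :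
    (r * t - t ^ 2 - s * (1 - s)) ^ 2 < 4 * (s * (1 - s)) * t ^ 2 := by
  have hσ : 0 < s * (1 - s) := mul_pos hs0 (by linarith)
  have hmt : t ^ 2 ≤ r * t - t ^ 2 := by nlinarith
  rcases lt_trichotomy (s * (1 - s)) (r * t - t ^ 2) with h | h | h
  · rcases le_total s (1/5) with h5 | h5
    · have h1 : r * t - t ^ 2 - s * (1 - s) ≤ 2 * s ^ 2 := by nlinarith
      have h2 : (r * t - t ^ 2 - s * (1 - s)) ^ 2 ≤ (2 * s ^ 2) ^ 2 :=
        pow_le_pow_left₀ (by linarith) h1 2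
      have h3 : (s * (1 - s)) ^ 2 < (r * t) ^ 2 :=
        pow_lt_pow_left₀ (by nlinarith) hσ.le (by norm_num)
      have h4 : (r * t) ^ 2 ≤ 2 * t ^ 2 := by
        rw [mul_pow]; exact mul_le_mul_of_nonneg_right hr2 (sq_nonneg t)
      have h6 : 2 * s ≤ (1 - s) ^ 3 := by
        have : (4/5 : ℝ) ^ 3 ≤ (1 - s) ^ 3 := pow_le_pow_left₀ (by norm_num) (by linarith) 3
        linarith
      have h7 : (2 * s ^ 2) ^ 2 ≤ 2 * (s * (1 - s)) * (s * (1 - s)) ^ 2 := by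
        have := mul_le_mul_of_nonneg_left h6 (by positivity : 0 ≤ 2 * s ^ 3)
        nlinarith
      have h8 := mul_lt_mul_of_pos_left (h3.trans_le h4) hσ
      nlinarith
    · obtain ⟨q, hq0, hq⟩ : ∃ q : ℝ, 0 < q ∧ q ^ 2 = s * (1 - s) :=
        ⟨√(s * (1 - s)), Real.sqrt_pos.2 hσ, Real.sq_sqrt hσ.le⟩
      rw [← hq] at h ⊢
      have hq2 : 4/25 ≤ q ^ 2 := by nlinarith
      have hq3 : 2/5 ≤ q := by nlinarith
      have hr3 : r < 3/2 := by nlinarith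
      have : r * t - t ^ 2 - q ^ 2 < 2 * q * t := by nlinarith [sq_nonneg (t - q)]
      have := pow_lt_pow_left₀ this (by linarith) (two_ne_zero)
      nlinarith
  · rw [← h]; simp; positivity
  · have h1 : (r * t - t ^ 2 - s * (1 - s)) ^ 2 ≤ (2 * t ^ 2) ^ 2 := by
      apply sq_le_sq'
      · linarith
      · nlinarith [sq_nonneg t]
    have := mul_lt_mul_of_pos_right (hmt.trans_lt h) (by positivity : 0 < t ^ 2)
    nlinarith

theorem ineqU2 (r s t : ℝ) (hr2 : r ^ 2 ≤ 2) (hs0 : 0 ≤ s) (hs : s ≤ 1/2) (ht0 : 0 < t)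
    (ht : t ≤ r / 2) :
    (r * t - t ^ 2) ^ 2 + s ^ 4 + 2 * s ^ 2 * t ^ 2 < s ^ 2 + 2 * t ^ 2 := by
  have h1 : (r - t) ^ 2 ≤ 2 - 3 * t ^ 2 := by nlinarith
  have h2 := mul_le_mul_of_nonneg_left h1 (sq_nonneg t)
  have h3 : s ^ 2 ≤ 1/4 := by nlinarith
  have h4 : t ^ 2 ≤ 1/2 := by nlinarith
  have h5 : 0 < t ^ 2 := by positivity
  have h6 : s ^ 2 * s ^ 2 ≤ s ^ 2 * (1/4) := mul_le_mul_of_nonneg_left h3 (sq_nonneg s)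
  have h7 : s ^ 2 * (2 * t ^ 2 - 3/4) < 3 * (t ^ 2) ^ 2 := by
    rcases le_total (2 * t ^ 2) (3/4) with h | h
    · have : s ^ 2 * (2 * t ^ 2 - 3/4) ≤ 0 := mul_nonpos_of_nonneg_of_nonpos (sq_nonneg s) (by linarith)
      have : 0 < 3 * (t ^ 2) ^ 2 := by positivity
      linarith
    · nlinarith [sq_nonneg s]
  nlinarith

def P (r s t : ℝ) : Set (ℝ × ℝ) := {p | |p.1| ≤ r / 2 ∧
  (p.2 - s) ^ 2 + (p.1 - t) ^ 2 < p.2 ^ 2 + p.1 ^ 2 ∧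
  (p.2 - s) ^ 2 + (p.1 - t) ^ 2 < (p.2 - 1) ^ 2 + p.1 ^ 2 ∧
  (p.2 - s) ^ 2 + (p.1 - t) ^ 2 < (p.2 + 1) ^ 2 + p.1 ^ 2}

set_option maxHeartbeats 4000000 in
theorem keyvol (r s t : ℝ) (hr : 0 < r) (hr2 : r ^ 2 ≤ 2) (hs0 : 0 ≤ s) (hs : s ≤ 1/2)
    (ht0 : 0 < t) (ht : t ≤ r / 2) : volume (P r s t) < ENNReal.ofReal (r / 2) := by
  have h1s : 0 < 1 - s := by linarith
  have h1s' : 0 < 1 + s := by linarith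
  have hr' : 0 < r / 2 := by linarith
  have hmt : t ^ 2 ≤ r * t - t ^ 2 := by nlinarith
  have ht2 : 0 < t ^ 2 := by positivity
  have b0 : ∀ p ∈ P r s t, 0 < s → (-(t/s)) * p.1 + (s^2+t^2)/(2*s) < p.2 := by
    rintro ⟨v, u⟩ ⟨h, h0, h1, h2⟩ hs'
    simp only at *
    rw [show (-(t/s)) * v + (s^2+t^2)/(2*s) = (s^2+t^2-2*t*v)/(2*s) by field_simp; ring,
      div_lt_iff₀ (by positivity)]
    nlinarith
  have b1 : ∀ p ∈ P r s t, p.2 < (t/(1-s)) * p.1 + (1-s^2-t^2)/(2*(1-s)) := by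
    rintro ⟨v, u⟩ ⟨h, h0, h1, h2⟩
    simp only at *
    rw [show (t/(1-s)) * v + (1-s^2-t^2)/(2*(1-s)) = (1-s^2-t^2+2*t*v)/(2*(1-s)) by field_simp; ring,
      lt_div_iff₀ (by positivity)]
    nlinarith
  have b2 : ∀ p ∈ P r s t, (-(t/(1+s))) * p.1 + (s^2+t^2-1)/(2*(1+s)) < p.2 := by
    rintro ⟨v, u⟩ ⟨h, h0, h1, h2⟩
    simp only at *
    rw [show (-(t/(1+s))) * v + (s^2+t^2-1)/(2*(1+s)) = (s^2+t^2-1-2*t*v)/(2*(1+s)) by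
      field_simp; ring, div_lt_iff₀ (by positivity)]
    nlinarith
  have w01 : ∀ y : ℝ, 0 < s → (t/(1-s)) * y + (1-s^2-t^2)/(2*(1-s)) -
      ((-(t/s)) * y + (s^2+t^2)/(2*s)) = (s*(1-s) - t^2+2*t*y)/(2*(s*(1-s))) := by
    intro y hs'
    field_simp; ring
  have w21 : ∀ y : ℝ, (t/(1-s)) * y + (1-s^2-t^2)/(2*(1-s)) -
      ((-(t/(1+s))) * y + (s^2+t^2-1)/(2*(1+s))) = (1-s^2 - t^2+2*t*y)/((1+s)*(1-s)) := by
    intro y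
    field_simp; ring
  -- lower bound on v
  have blow : ∀ p ∈ P r s t, (t^2 - s*(1-s))/(2*t) ≤ p.1 := by
    rintro ⟨v, u⟩ ⟨h, h0, h1, h2⟩
    simp only at *
    rw [div_le_iff₀ (by positivity)]
    nlinarith
  have babs : ∀ p ∈ P r s t, -(r/2) ≤ p.1 ∧ p.1 ≤ r/2 := fun p hp => abs_le.1 hp.1
  by_cases hT : r * t + t ^ 2 < s * (1 - s)
  · have hs' : 0 < s := by
      rcases hs0.lt_or_eq with h | h
      · exact h
      · subst h; nlinarith
    have hσ : 0 < s * (1 - s) := mul_pos hs' h1s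
    have hA := w01 (-(r/2)) hs'
    have hB := w01 (r/2) hs'
    refine (trap (P r s t) (-(r/2)) (r/2) _ _ _ _ (by linarith) ?_ ?_
      (fun p hp => ⟨(babs p hp).1, (babs p hp).2, b0 p hp hs', b1 p hp⟩)).trans_lt ?_
    · rw [← sub_nonneg, hA]; apply div_nonneg <;> nlinarith
    · rw [← sub_nonneg, hB]; apply div_nonneg <;> nlinarith
    · rw [hA, hB, ENNReal.ofReal_lt_ofReal_iff hr', ← add_div, ← mul_div_assoc, div_div, div_lt_div_iff₀ (by positivity) (by positivity)]
      have := mul_pos hr ht2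
      nlinarith
  push Not at hT
  by_cases hU : r * t - t ^ 2 ≤ s ^ 2 + s
  · have hs' : 0 < s := by
      rcases hs0.lt_or_eq with h | h
      · exact h
      · subst h; nlinarith
    have hσ : 0 < s * (1 - s) := mul_pos hs' h1s
    have hA := w01 ((t^2 - s*(1-s))/(2*t)) hs'
    have hB := w01 (r/2) hs'
    have hA' : s*(1-s) - t^2+2*t*((t^2 - s*(1-s))/(2*t)) = 0 := by field_simp; ring
    rw [hA', zero_div] at hA
    have key := ineqU1 r s t hr2 hs' hs ht0 ht hT hU
    refine (trap (P r s t) ((t^2 - s*(1-s))/(2*t)) (r/2) _ _ _ _ ?_ ?_ ?_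
      (fun p hp => ⟨blow p hp, (babs p hp).2, b0 p hp hs', b1 p hp⟩)).trans_lt ?_
    · rw [div_le_iff₀ (by positivity)]; nlinarith
    · rw [← sub_nonneg, hA]
    · rw [← sub_nonneg, hB]; apply div_nonneg <;> nlinarith
    · rw [hA, hB, ENNReal.ofReal_lt_ofReal_iff hr', zero_add]
      rw [show (r / 2 - (t ^ 2 - s * (1 - s)) / (2 * t)) = (r*t - t^2 + s*(1-s))/(2*t) by field_simp; ring,
        div_mul_div_comm, div_div, div_lt_div_iff₀ (by positivity) (by positivity)]
      nlinarith
  push Not at hU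
  set yA : ℝ := (t^2 + s^2 + s)/(2*t) with hyA
  have hyA' : 2 * t * yA = t^2 + s^2 + s := by rw [hyA]; field_simp
  have hyr : yA ≤ r/2 := by rw [hyA, div_le_iff₀ (by positivity)]; nlinarith
  have piece2 : volume (P r s t ∩ {p | yA ≤ p.1}) ≤
      ENNReal.ofReal ((r*t-t^2-s^2-s)*(2 + s+(r*t-t^2-s^2))/(4*t*((1+s)*(1-s)))) := by
    have hA := w21 yA
    have hB := w21 (r/2)
    refine (trap _ yA (r/2) _ _ _ _ hyr ?_ ?_
      (fun p hp => ⟨hp.2, (babs p hp.1).2, b2 p hp.1, b1 p hp.1⟩)).trans_eq ?_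
    · rw [← sub_nonneg, hA]; apply div_nonneg <;> nlinarith
    · rw [← sub_nonneg, hB]; apply div_nonneg <;> nlinarith
    · rw [hA, hB, hyA', hyA]
      congr 1
      field_simp; ring
  have piece1 : volume (P r s t ∩ {p | p.1 < yA}) ≤ ENNReal.ofReal (s/(2*t*(1-s))) := by
    rcases hs0.lt_or_eq with hs' | hs'
    · have hσ : 0 < s * (1 - s) := mul_pos hs' h1s
      have hA := w01 ((t^2 - s*(1-s))/(2*t)) hs'
      have hB := w01 yA hs'
      have hA' : s*(1-s) - t^2+2*t*((t^2 - s*(1-s))/(2*t)) = 0 := by field_simp; ring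
      rw [hA', zero_div] at hA
      refine (trap _ ((t^2 - s*(1-s))/(2*t)) yA _ _ _ _ ?_ ?_ ?_
        (fun p hp => ⟨blow p hp.1, hp.2.le, b0 p hp.1 hs', b1 p hp.1⟩)).trans_eq ?_
      · rw [hyA]; gcongr; nlinarith
      · rw [← sub_nonneg, hA]
      · rw [← sub_nonneg, hB]; apply div_nonneg <;> nlinarith
      · rw [hA, hB, hyA', hyA]
        congr 1
        field_simp; ring
    · have : P r s t ∩ {p | p.1 < yA} = ∅ := by
        ext p
        simp only [mem_inter_iff, mem_ofPred_eq, mem_empty_iff_false, iff_false, not_and, not_lt]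
        intro hp
        have := blow p hp
        rw [hyA]
        rw [← hs'] at this ⊢
        simpa using this
      rw [this]; simp
  have hsplit : P r s t ⊆ (P r s t ∩ {p | p.1 < yA}) ∪ (P r s t ∩ {p | yA ≤ p.1}) := by
    intro p hp
    rcases lt_or_ge p.1 yA with h | h
    · exact Or.inl ⟨hp, h⟩
    · exact Or.inr ⟨hp, h⟩
  refine (measure_mono hsplit).trans_lt ((measure_union_le _ _).trans_lt ((add_le_add piece1 piece2).trans_lt ?_))
  rw [← ENNReal.ofReal_add (by positivity) (by apply div_nonneg <;> nlinarith [mul_pos ht0 (mul_pos h1s' h1s)]), ENNReal.ofReal_lt_ofReal_iff hr',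
    show s/(2*t*(1-s)) = (2 * s*(1+s))/(4*t*((1+s)*(1-s))) by field_simp; ring, ← add_div,
    div_lt_div_iff₀ (by positivity) (by norm_num)]
  have key := ineqU2 r s t hr2 hs0 hs ht0 ht
  nlinarith

theorem keyvol0 (r s : ℝ) (hr : 0 < r) (hs0 : 0 ≤ s) (hs : s ≤ 1/2) :
    volume (P r s 0) ≤ ENNReal.ofReal (r / 2) := by
  rcases hs0.lt_or_eq with hs' | hs'
  · refine (trap (P r s 0) (-(r/2)) (r/2) 0 (s/2) 0 ((1+s)/2) (by linarith) (by linarith) (by linarith) ?_).trans_eq ?_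
    · rintro ⟨v, u⟩ ⟨h, h0, h1, h2⟩
      simp only at *
      have := abs_le.1 h
      refine ⟨this.1, this.2, ?_, ?_⟩ <;> nlinarith
    · congr 1; ring
  · have : P r s 0 = ∅ := by
      ext ⟨v, u⟩
      simp [P, ← hs']
    rw [this]; simp
theorem affmap (a b : ℝ) (ha : a ≠ 0) :
    Measure.map (fun x : ℝ => a * x + b) volume = ENNReal.ofReal |a⁻¹| • volume := by
  have : (fun x : ℝ => a * x + b) = (fun x => x + b) ∘ (fun x => a * x) := rfl
  rw [this, ← Measure.map_map (by fun_prop) (by fun_prop), Real.map_volume_mul_left ha,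
    Measure.map_smul, map_add_right_eq_self]

theorem pull (a b c d : ℝ) (ha : a ≠ 0) (hc : c ≠ 0) (T : Set (ℝ × ℝ))
    (S : Set (EuclideanSpace ℝ (Fin 2)))
    (hS : ∀ q ∈ S, (c * q 1 + d, a * q 0 + b) ∈ T) :
    volume S ≤ ENNReal.ofReal (|c⁻¹| * |a⁻¹|) * volume T := by
  set F : ℝ × ℝ → ℝ × ℝ := Prod.map (fun x => a * x + b) (fun x => c * x + d) with hF
  have hFm : Measurable F := by fun_prop
  have h1 : MeasurePreserving (fun q : EuclideanSpace ℝ (Fin 2) => (q 0, q 1)) volume volume :=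
    (volume_preserving_finTwoArrow ℝ).comp (PiLp.volume_preserving_ofLp (Fin 2))
  have h2 : Measure.map F volume = ENNReal.ofReal (|c⁻¹| * |a⁻¹|) • volume := by
    rw [Measure.volume_eq_prod, hF, ← Measure.map_prod_map _ _ (by fun_prop) (by fun_prop),
      affmap a b ha, affmap c d hc, Measure.prod_smul_left]
    rw [ENNReal.ofReal_mul (abs_nonneg _), mul_comm, mul_smul]
    congr 1
    ext s hs
    rw [← Measure.prod_swap, Measure.prod_smul_left, Measure.map_smul, Measure.prod_swap]
  have h3 : MeasurePreserving (Prod.swap : ℝ × ℝ → ℝ × ℝ) volume volume := 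
    Measure.measurePreserving_swap
  set T' := toMeasurable volume T
  have hT' : MeasurableSet T' := measurableSet_toMeasurable _ _
  have hsub : S ⊆ (fun q : EuclideanSpace ℝ (Fin 2) => (q 0, q 1)) ⁻¹' (F ⁻¹' (Prod.swap ⁻¹' T')) := by
    intro q hq
    exact subset_toMeasurable _ _ (hS q hq)
  refine (measure_mono hsub).trans_eq ?_
  rw [h1.measure_preimage (hFm (measurable_swap hT')).nullMeasurableSet,
    ← Measure.map_apply hFm (measurable_swap hT'), h2, Measure.smul_apply,
    h3.measure_preimage hT'.nullMeasurableSet, measure_toMeasurable, smul_eq_mul]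

abbrev E2 := EuclideanSpace ℝ (Fin 2)

def RR (n : ℕ) (ρ : ℝ) (b : E2) : Set E2 := {q | q ∈ board ρ ∧ ∀ k : ℤ,
  (n * q 0 - n * b 0) ^ 2 + (n * q 1 - n * b 1) ^ 2 <
    (n * q 0 - 1/2 - k) ^ 2 + (n * q 1 - n * ρ / 2) ^ 2}

theorem cover (n : ℕ) (hn : 3 ≤ n) (ρ : ℝ)
    (W : Set E2)
    (hW : W = Set.range fun i : Fin n => pt ((2 * (i : ℝ) + 1) / (2 * n)) (ρ / 2))
    (B : Set E2) (hBfin : B.Finite) (hBne : B.Nonempty) :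
    ∀ q, q ∈ board ρ → infDist q B < infDist q W → ∃ b ∈ B, q ∈ RR n ρ b := by
  intro q hq hlt
  have hn0 : (0:ℝ) < n := by positivity
  obtain ⟨b, hb, hbd⟩ := hBfin.isCompact.exists_infDist_eq_dist hBne q
  refine ⟨b, hb, hq, ?_⟩
  have hi : ∀ i : Fin n, (n * q 0 - n * b 0) ^ 2 + (n * q 1 - n * b 1) ^ 2 <
    (n * q 0 - 1/2 - (i:ℝ)) ^ 2 + (n * q 1 - n * ρ / 2) ^ 2 := by
    intro i
    have h1 : dist q b < dist q (pt ((2 * (i : ℝ) + 1) / (2 * n)) (ρ / 2)) := by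
      rw [← hbd]
      exact hlt.trans_le (infDist_le_dist_of_mem (by rw [hW]; exact ⟨i, rfl⟩))
    rw [EuclideanSpace.dist_eq, EuclideanSpace.dist_eq] at h1
    have h2 := Real.lt_sqrt (by positivity) |>.1 h1
    rw [Real.sq_sqrt (by positivity)] at h2
    simp only [Fin.sum_univ_two, Real.dist_eq, sq_abs, pt, WithLp.equiv_symm_apply] at h2
    simp at h2
    have h3 := mul_lt_mul_of_pos_left h2 (by positivity : (0:ℝ) < n ^ 2)
    have e : (n:ℝ) * ((2 * (i : ℝ) + 1) / (2 * n)) = i + 1/2 := by field_simp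
    have e2 : (n * q 0 - 1/2 - (i:ℝ)) ^ 2 = (n:ℝ)^2 * (q 0 - (2 * (i : ℝ) + 1) / (2 * n)) ^ 2 := by
      rw [← mul_pow, mul_sub, e]; ring
    rw [e2]
    nlinarith
  intro k
  obtain ⟨⟨h0, h1⟩, -⟩ := hq
  have hx1 : n * q 0 ≤ n := by nlinarith
  have hx0 : 0 ≤ n * q 0 := by positivity
  rcases lt_or_ge k 0 with hk | hk
  · refine (hi ⟨0, by omega⟩).trans_le ?_
    have : (k:ℝ) ≤ -1 := by exact_mod_cast (by omega : k ≤ -1)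
    simp only [Nat.cast_zero]
    nlinarith
  rcases lt_or_ge k n with hk' | hk'
  · have := hi ⟨k.toNat, by omega⟩
    have e : ((k.toNat : ℕ) : ℝ) = (k : ℝ) := by
      exact_mod_cast Int.toNat_of_nonneg hk
    simpa only [e] using this
  · refine (hi ⟨n-1, by omega⟩).trans_le ?_
    have : (n:ℝ) ≤ k := by exact_mod_cast hk'
    have e : ((n - 1 : ℕ) : ℝ) = (n:ℝ) - 1 := by
      rw [Nat.cast_sub (by omega)]; simp
    simp only [e]
    nlinarith

theorem scale (n : ℕ) (hn : 3 ≤ n) (ρ : ℝ) :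
    ∀ x : ℝ, ENNReal.ofReal (|(n:ℝ)⁻¹| * |(n:ℝ)⁻¹|) * ENNReal.ofReal (n * ρ * x) =
      ENNReal.ofReal (ρ * x / n) := by
  intro x
  have hn0 : (0:ℝ) < n := by positivity
  rw [← ENNReal.ofReal_mul (by positivity), abs_of_pos (by positivity)]
  congr 1
  field_simp

theorem red (n : ℕ) (hn : 3 ≤ n) (ρ : ℝ) (hρ0 : 0 < ρ) (b : E2) (hb : b ∈ board ρ) :
    ∃ s t : ℝ, 0 ≤ s ∧ s ≤ 1/2 ∧ 0 ≤ t ∧ t ≤ n * ρ / 2 ∧ (t = 0 → n * b 1 - n * ρ / 2 = 0) ∧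
      volume (RR n ρ b) ≤ ENNReal.ofReal (|(n:ℝ)⁻¹| * |(n:ℝ)⁻¹|) * volume (P (n * ρ) s t) := by
  have hn0 : (0:ℝ) < n := by positivity
  obtain ⟨-, hy0, hy1⟩ := hb
  set X := n * b 0 - 1/2 with hX
  set Y := n * b 1 - n * ρ / 2 with hY
  have hYa : |Y| ≤ n * ρ / 2 := by
    rw [abs_le, hY]; constructor <;> nlinarith
  have hXa := abs_sub_round X
  obtain ⟨ε, hε, hεX⟩ : ∃ ε : ℤ, (ε = 1 ∨ ε = -1) ∧ |X - round X| = ε * (X - round X) := by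
    rcases abs_choice (X - round X) with h | h
    · exact ⟨1, Or.inl rfl, by rw [h]; simp⟩
    · exact ⟨-1, Or.inr rfl, by rw [h]; push_cast; ring⟩
  obtain ⟨δ, hδ, hδY⟩ : ∃ δ : ℝ, (δ = 1 ∨ δ = -1) ∧ |Y| = δ * Y := by
    rcases abs_choice Y with h | h
    · exact ⟨1, Or.inl rfl, by rw [h]; simp⟩
    · exact ⟨-1, Or.inr rfl, by rw [h]; simp⟩
  refine ⟨|X - round X|, |Y|, abs_nonneg _, hXa, abs_nonneg _, hYa, fun h => abs_eq_zero.1 h, ?_⟩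
  have hε2 : (ε:ℝ) ^ 2 = 1 := by rcases hε with h | h <;> simp [h]
  have hδ2 : δ ^ 2 = 1 := by rcases hδ with h | h <;> simp [h]
  have hεa : |(ε:ℝ)| = 1 := by rcases hε with h | h <;> simp [h]
  have hδa : |δ| = 1 := by rcases hδ with h | h <;> simp [h]
  have main := pull (ε * n) (ε * (-1/2 - round X)) (δ * n) (δ * (-(n * ρ / 2)))
    (by rw [← abs_pos, abs_mul, hεa]; simpa using hn0) (by rw [← abs_pos, abs_mul, hδa]; simpa using hn0)
    (P (n * ρ) |X - round X| |Y|) (RR n ρ b) ?_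
  · have e1 : |((ε:ℝ) * n)⁻¹| = |(n:ℝ)⁻¹| := by rw [abs_inv, abs_mul, hεa, one_mul, abs_inv]
    have e2 : |(δ * n)⁻¹| = |(n:ℝ)⁻¹| := by rw [abs_inv, abs_mul, hδa, one_mul, abs_inv]
    rwa [e1, e2] at main
  rintro q ⟨⟨-, hq0, hq1⟩, hq⟩
  have ev : δ * n * q 1 + δ * (-(n * ρ / 2)) = δ * (n * q 1 - n * ρ / 2) := by ring
  have eu : ε * n * q 0 + ε * (-1/2 - round X) = ε * (n * q 0 - 1/2 - round X) := by ring
  rw [ev, eu, hεX, hδY]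
  have gen : ∀ j : ℤ, (ε * (n * q 0 - 1/2 - round X) - ε * (X - round X)) ^ 2 +
      (δ * (n * q 1 - n * ρ / 2) - δ * Y) ^ 2 <
      (ε * (n * q 0 - 1/2 - round X) - j) ^ 2 + (δ * (n * q 1 - n * ρ / 2)) ^ 2 := by
    intro j
    have h := hq (round X + ε * j)
    push_cast at h
    have a1 : (ε * (n * q 0 - 1/2 - round X) - ε * (X - round X)) ^ 2 = (n * q 0 - n * b 0) ^ 2 := by
      rw [← mul_sub, mul_pow, hε2, hX]; ring
    have a2 : (δ * (n * q 1 - n * ρ / 2) - δ * Y) ^ 2 = (n * q 1 - n * b 1) ^ 2 := by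
      rw [← mul_sub, mul_pow, hδ2, hY]; ring
    have a3 : (ε * (n * q 0 - 1/2 - round X) - j) ^ 2 = (n * q 0 - 1/2 - (round X + ε * j)) ^ 2 := by
      linear_combination ((n * q 0 - 1/2 - round X) ^ 2 - (j:ℝ)^2) * hε2
    have a4 : (δ * (n * q 1 - n * ρ / 2)) ^ 2 = (n * q 1 - n * ρ / 2) ^ 2 := by
      rw [mul_pow, hδ2, one_mul]
    rw [a1, a2, a3, a4]
    exact h
  refine ⟨?_, ?_, ?_, ?_⟩
  · show |δ * (n * q 1 - n * ρ / 2)| ≤ n * ρ / 2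
    rw [abs_mul, hδa, one_mul, abs_le]; constructor <;> nlinarith
  · simpa using gen 0
  · simpa using gen 1
  · simpa using gen (-1)

theorem strip (n : ℕ) (hn : 3 ≤ n) (ρ : ℝ) (hρ0 : 0 < ρ) (x0 x1 : ℝ) (hx : x0 ≤ x1) (S : Set E2)
    (hS : ∀ q ∈ S, q ∈ board ρ ∧ x0 < n * q 0 - 1/2 ∧ n * q 0 - 1/2 < x1) :
    volume S ≤ ENNReal.ofReal (ρ * (x1 - x0) / n) := by
  have hn0 : (0:ℝ) < n := by positivity
  rw [← scale n hn ρ]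
  refine (pull n (-1/2) n 0 hn0.ne' hn0.ne' (Icc 0 (n * ρ) ×ˢ Ioo x0 x1) S ?_).trans ?_
  · intro q hq
    obtain ⟨⟨-, h0, h1⟩, h2, h3⟩ := hS q hq
    refine ⟨⟨?_, ?_⟩, ?_, ?_⟩
    · show 0 ≤ n * q 1 + 0
      positivity
    · show n * q 1 + 0 ≤ n * ρ
      nlinarith
    · show x0 < n * q 0 + -1/2
      linarith
    · show n * q 0 + -1/2 < x1
      linarith
  · rw [Measure.volume_eq_prod, Measure.prod_prod, Real.volume_Icc, Real.volume_Ioo, 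
      ← ENNReal.ofReal_mul (by rw [sub_zero]; positivity : 0 ≤ n * ρ - 0), sub_zero]

theorem fin (n : ℕ) (ρ : ℝ) (c : ℝ≥0∞) (hc : c ≠ ⊤) (S U : Set E2) (F : Finset E2)
    (m : ℕ) (hm : m + F.card = n)
    (hS : ∀ q ∈ S, q ∈ U ∨ ∃ b ∈ F, q ∈ RR n ρ b) (hU : volume U < m * c)
    (hF : ∀ b ∈ F, volume (RR n ρ b) ≤ c) : volume S < n * c := by
  have hsub : S ⊆ U ∪ ⋃ b ∈ F, RR n ρ b := by
    intro q hq
    rcases hS q hq with h | ⟨b, hb, h⟩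
    · exact Or.inl h
    · exact Or.inr (mem_biUnion hb h)
  have h1 : volume (⋃ b ∈ F, RR n ρ b) ≤ F.card * c := by
    refine (measure_biUnion_finset_le _ _).trans ((Finset.sum_le_sum hF).trans_eq ?_)
    simp
  refine (measure_mono hsub).trans_lt ((measure_union_le _ _).trans_lt ?_)
  have e : (n : ℝ≥0∞) * c = m * c + F.card * c := by
    rw [← hm]; push_cast; rw [add_mul]
  rw [e]
  exact ENNReal.add_lt_add_of_lt_of_le (h1.trans_lt (by finiteness)).ne hU h1

theorem online (n : ℕ) (ρ : ℝ) (b : E2) (hY : n * b 1 - n * ρ / 2 = 0) (q : E2)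
    (hq : q ∈ RR n ρ b) (k : ℤ) (h0 : (k:ℝ) < n * b 0 - 1/2)
    (h1 : n * b 0 - 1/2 < k + 1) :
    (k + (n * b 0 - 1/2)) / 2 < n * q 0 - 1/2 ∧ n * q 0 - 1/2 < (k + 1 + (n * b 0 - 1/2)) / 2 := by
  have a0 := hq.2 k
  have a1 := hq.2 (k+1)
  push_cast at a1
  have e : n * b 1 = n * ρ / 2 := by linarith
  rw [e] at a0 a1
  constructor <;> nlinarith

/-- For `n ≥ 3` and `ρ ≤ √2 / n`, Wilma wins by playing the `1 × n` grid
`W = {((2i−1)/(2n), ρ/2) : i = 1, …, n}`: every placement of `n` black points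
claims strictly less than half the board. -/
theorem stmt_1 (n : ℕ) (hn : 3 ≤ n) (ρ : ℝ) (hρ0 : 0 < ρ) (hρ1 : ρ ≤ Real.sqrt 2 / n)
    (W : Set (EuclideanSpace ℝ (Fin 2)))
    (hW : W = Set.range fun i : Fin n => pt ((2 * (i : ℝ) + 1) / (2 * n)) (ρ / 2))
    (B : Set (EuclideanSpace ℝ (Fin 2))) (hBQ : B ⊆ board ρ) (hBfin : B.Finite)
    (hBcard : B.ncard = n) :
    volume {q | q ∈ board ρ ∧ infDist q B < infDist q W} < ENNReal.ofReal (ρ / 2) := by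
  have hn0 : (0:ℝ) < n := by positivity
  set c : ℝ≥0∞ := ENNReal.ofReal (ρ * (1/2) / n) with hc
  have hcpos : 0 < ρ * (1/2) / n := by positivity
  have hctop : c ≠ ⊤ := ENNReal.ofReal_ne_top
  have htot : (n : ℝ≥0∞) * c = ENNReal.ofReal (ρ / 2) := by
    rw [hc, ← ENNReal.ofReal_natCast, ← ENNReal.ofReal_mul (by positivity)]
    congr 1; field_simp
  rw [← htot]
  have hr0 : 0 < n * ρ := by positivity
  have hr2 : (n * ρ) ^ 2 ≤ 2 := by
    have : n * ρ ≤ √2 := by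
      rw [le_div_iff₀ hn0] at hρ1; linarith
    calc (n * ρ) ^ 2 ≤ (√2) ^ 2 := pow_le_pow_left₀ hr0.le this 2
      _ = 2 := Real.sq_sqrt (by norm_num)
  have hsc : ENNReal.ofReal (|(n:ℝ)⁻¹| * |(n:ℝ)⁻¹|) * ENNReal.ofReal (n * ρ / 2) = c := by
    rw [hc, ← scale n hn ρ, mul_one_div]
  have hle : ∀ b ∈ B, volume (RR n ρ b) ≤ c := by
    intro b hb
    obtain ⟨s, t, hs0, hs1, ht0, ht1, -, hv⟩ := red n hn ρ hρ0 b (hBQ hb)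
    refine hv.trans ?_
    rw [← hsc]
    gcongr
    rcases ht0.lt_or_eq with h | h
    · exact (keyvol _ s t hr0 hr2 hs0 hs1 h ht1).le
    · rw [← h]; exact keyvol0 _ s hr0 hs0 hs1
  have hoff : ∀ b ∈ B, n * b 1 - n * ρ / 2 ≠ 0 → volume (RR n ρ b) < c := by
    intro b hb hne
    obtain ⟨s, t, hs0, hs1, ht0, ht1, ht, hv⟩ := red n hn ρ hρ0 b (hBQ hb)
    refine hv.trans_lt ?_
    rw [← hsc]
    have htp : 0 < t := lt_of_le_of_ne ht0 (fun h => hne (ht h.symm))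
    refine ENNReal.mul_lt_mul_right ?_ ENNReal.ofReal_ne_top (keyvol _ s t hr0 hr2 hs0 hs1 htp ht1)
    simp only [ne_eq, ENNReal.ofReal_eq_zero, not_le]
    positivity
  have hBne : B.Nonempty := by
    rw [← ncard_pos hBfin]; omega
  have hcov := cover n hn ρ W hW B hBfin hBne
  set F := hBfin.toFinset with hF
  have hmem : ∀ b, b ∈ F ↔ b ∈ B := fun b => hBfin.mem_toFinset
  have hcard : F.card = n := by rw [← hBcard, ncard_eq_toFinset_card B hBfin]
  classical
  by_cases hex : ∃ b ∈ B, volume (RR n ρ b) < c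
  · obtain ⟨b, hb, hlt⟩ := hex
    refine fin n ρ c hctop _ (RR n ρ b) (F.erase b) 1 ?_ ?_ (by simpa using hlt) ?_
    · rw [Finset.card_erase_of_mem ((hmem b).2 hb)]; omega
    · rintro q ⟨hq, hlt'⟩
      obtain ⟨b', hb', hq'⟩ := hcov q hq hlt'
      by_cases h : b' = b
      · left; rwa [← h]
      · right; exact ⟨b', Finset.mem_erase.2 ⟨h, (hmem _).2 hb'⟩, hq'⟩
    · intro b' hb'
      exact hle b' ((hmem _).1 (Finset.mem_of_mem_erase hb'))
  push Not at hex
  have hY : ∀ b ∈ B, n * b 1 - n * ρ / 2 = 0 := by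
    intro b hb
    by_contra h
    exact absurd (hoff b hb h) (not_lt.2 (hex b hb))
  have hfl : ∀ b ∈ B, ((⌊n * b 0 - 1/2⌋ : ℤ) : ℝ) < n * b 0 - 1/2 := by
    intro b hb
    refine lt_of_le_of_ne (Int.floor_le _) (fun h => ?_)
    refine absurd ?_ (not_lt.2 (hex b hb))
    have : RR n ρ b = ∅ := by
      rw [eq_empty_iff_forall_notMem]
      intro q hq
      have := hq.2 ⌊n * b 0 - 1/2⌋
      rw [h] at this
      have e : n * b 1 = n * ρ / 2 := by linarith [hY b hb]
      rw [e] at this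
      nlinarith
    rw [this, measure_empty, hc]
    exact ENNReal.ofReal_pos.2 hcpos
  have hfl' : ∀ b : EuclideanSpace ℝ (Fin 2), n * b 0 - 1/2 < ((⌊n * b 0 - 1/2⌋ : ℤ) : ℝ) + 1 :=
    fun b => Int.lt_floor_add_one _
  have hmaps : ∀ b ∈ F, ⌊n * b 0 - 1/2⌋ ∈ Finset.Ico (0:ℤ) (n - 1) := by
    intro b hb'
    have hb := (hmem b).1 hb'
    have g0 := hfl b hb
    have g1 := hfl' b
    obtain ⟨⟨hx0, hx1⟩, -⟩ := hBQ hb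
    have hnx0 : 0 ≤ n * b 0 := by positivity
    have hnx1 : n * b 0 ≤ n := by nlinarith
    set k := ⌊n * b 0 - 1/2⌋ with hk
    rw [Finset.mem_Ico]
    have hstr : ∀ x0 x1 : ℝ, x0 ≤ x1 → x1 - x0 < 1/2 → 
        (∀ q ∈ RR n ρ b, x0 < n * q 0 - 1/2 ∧ n * q 0 - 1/2 < x1) → False := by
      intro x0 x1 hx hlt hq
      refine absurd ?_ (not_lt.2 (hex b hb))
      refine (strip n hn ρ hρ0 x0 x1 hx (RR n ρ b) (fun q h => ⟨h.1, hq q h⟩)).trans_lt ?_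
      rw [hc, ENNReal.ofReal_lt_ofReal_iff hcpos]
      gcongr
    constructor
    · by_contra hneg
      have hk1 : (k:ℝ) ≤ -1 := by exact_mod_cast (by omega : k ≤ -1)
      refine hstr (-1/2 + (n * b 0 - 1/2 - k - 1)/4) ((k + 1 + (n * b 0 - 1/2)) / 2) ?_ ?_ ?_
      · have hk2 : (-2:ℤ) < k := by
          have : (-2:ℝ) < k := by linarith
          exact_mod_cast this
        have : (k:ℝ) = -1 := by exact_mod_cast (by omega : k = -1)
        rw [this] at g0 g1 ⊢
        linarith
      · linarith
      · intro q hq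
        refine ⟨?_, (online n ρ b (hY b hb) q hq k g0 g1).2⟩
        have := mul_nonneg hn0.le hq.1.1.1
        linarith
    · by_contra hneg
      have hk1 : (n:ℝ) - 1 ≤ k := by
        have : (n:ℤ) - 1 ≤ k := by omega
        exact_mod_cast this
      refine hstr ((k + (n * b 0 - 1/2)) / 2) (n - 1/2 + (n * b 0 - 1/2 - k)/4) ?_ ?_ ?_
      · linarith
      · linarith
      · intro q hq
        refine ⟨(online n ρ b (hY b hb) q hq k g0 g1).1, ?_⟩
        have := mul_le_mul_of_nonneg_left hq.1.1.2 hn0.le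
        linarith
  obtain ⟨b₁, hb₁, b₂, hb₂, hne, hfeq⟩ :=
    Finset.exists_ne_map_eq_of_card_lt_of_maps_to (s := F) (t := Finset.Ico (0:ℤ) (n - 1))
      (by rw [Int.card_Ico, hcard]; omega) hmaps
  have hxne : b₁ 0 ≠ b₂ 0 := by
    intro h
    apply hne
    ext i
    fin_cases i
    · exact h
    · have h1 := hY b₁ ((hmem _).1 hb₁)
      have h2 := hY b₂ ((hmem _).1 hb₂)
      have : (n:ℝ) * b₁ 1 = n * b₂ 1 := by linarith
      exact mul_left_cancel₀ hn0.ne' this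
  clear hmaps
  wlog hlt : b₁ 0 < b₂ 0 generalizing b₁ b₂
  · exact this b₂ hb₂ b₁ hb₁ hne.symm hfeq.symm hxne.symm (lt_of_le_of_ne (not_lt.1 hlt) hxne.symm)
  have hB₁ := (hmem _).1 hb₁
  have hB₂ := (hmem _).1 hb₂
  have hltn := mul_lt_mul_of_pos_left hlt hn0
  refine fin n ρ c hctop _ (RR n ρ b₁ ∪ RR n ρ b₂) ((F.erase b₁).erase b₂) 2 ?_ ?_ ?_ ?_
  · rw [Finset.card_erase_of_mem (Finset.mem_erase.2 ⟨hne.symm, hb₂⟩), Finset.card_erase_of_mem hb₁]; omega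
  · rintro q ⟨hq, hlt'⟩
    obtain ⟨b', hb', hq'⟩ := hcov q hq hlt'
    by_cases h : b' = b₁
    · left; left; rwa [← h]
    by_cases h2 : b' = b₂
    · left; right; rwa [← h2]
    · right; exact ⟨b', Finset.mem_erase.2 ⟨h2, Finset.mem_erase.2 ⟨h, (hmem _).2 hb'⟩⟩, hq'⟩
  · have g0 := hfl b₁ hB₁
    have g1 := hfl' b₁
    have g2 := hfl b₂ hB₂
    have g3 := hfl' b₂
    rw [← hfeq] at g2 g3
    set k := ⌊n * b₁ 0 - 1/2⌋ with hk
    refine (strip n hn ρ hρ0 ((k + (n * b₁ 0 - 1/2)) / 2) ((k + 1 + (n * b₂ 0 - 1/2)) / 2)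
      (by linarith) _ ?_).trans_lt ?_
    · rintro q (hq | hq)
      · have := online n ρ b₁ (hY b₁ hB₁) q hq k g0 g1
        exact ⟨hq.1, this.1, by linarith⟩
      · have := online n ρ b₂ (hY b₂ hB₂) q hq k g2 g3
        exact ⟨hq.1, by linarith, this.2⟩
    · have : (((2:ℕ) : ℝ≥0∞)) * c = ENNReal.ofReal (ρ * 1 / n) := by
        rw [hc, ← ENNReal.ofReal_natCast, ← ENNReal.ofReal_mul (by positivity)]
        congr 1; push_cast; field_simp
      rw [this, ENNReal.ofReal_lt_ofReal_iff (by positivity)]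
      gcongr
      linarith
  · intro b' hb'
    exact hle b' ((hmem _).1 (Finset.mem_of_mem_erase (Finset.mem_of_mem_erase hb')))
end
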